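/- Let n ≥ 1, s ∈ (0,1), β > 0 and let Ω ⊆ ℝⁿ be an open set. Let K satisfy the symmetry, growth and Hölder conditions (i)–(iii). Let f ∈ L²(Ω) and let u ∈ X(Ω) with ‖u‖_{L¹_β(ℝⁿ)} < ∞ be a solution of E_K(u,·) = f in Ω. Then for every ε ∈ (0, 2s) and every open set Ω′ whose closure is compact and contained in Ω, there exists a constant C > 0, depending only on n, s, β, λ, Λ, M, Γ, Ω, Ω′ and ε (and not on u or f), such that ‖u‖_{L²(Ω′)} + ( ∫_{ℝⁿ} ( |z|^{−(2s−ε)} ‖Δ_z² u‖_{L²(Ω′_{2z})} )² dz/|z|^n )^{1/2} ≤ C ( ‖u‖_{L²(Ω)} + ‖u‖_{L¹_β(ℝⁿ)} + ‖f‖_{L²(Ω)} ). (The left-hand side is an equivalent norm of the Sobolev space H^{2s−ε}(Ω′); in particular u ∈ H^{2s−ε}_loc(Ω).) -/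

import Mathlib

open MeasureTheory Set Metric

noncomputable section

abbrev V (n : ℕ) : Type := EuclideanSpace ℝ (Fin n)

variable {n : ℕ}

/-- The cross-shaped set `C_Ω = (ℝⁿ×ℝⁿ) \ ((ℝⁿ\Ω)×(ℝⁿ\Ω))`. -/
def crossSet (Ω : Set (V n)) : Set (V n × V n) := {p | p.1 ∈ Ω ∨ p.2 ∈ Ω}

/-- Membership in the energy space `X(Ω)`. -/
def MemX (Ω : Set (V n)) (K : V n → V n → ℝ) (u : V n → ℝ) : Prop :=
  Measurable u ∧ IntegrableOn (fun x => u x ^ 2) Ω ∧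
    IntegrableOn (fun p : V n × V n => (u p.1 - u p.2) ^ 2 * K p.1 p.2) (crossSet Ω)

/-- Membership in `X₀(Ω)`: member of `X(Ω)` vanishing a.e. outside `Ω`. -/
def MemX0 (Ω : Set (V n)) (K : V n → V n → ℝ) (u : V n → ℝ) : Prop :=
  MemX Ω K u ∧ ∀ᵐ x ∂(volume : Measure (V n)), x ∉ Ω → u x = 0

/-- The bilinear form `E_K(u,φ)`. -/
def energyForm (K : V n → V n → ℝ) (u φ : V n → ℝ) : ℝ :=
  ∫ x, ∫ y, (u x - u y) * (φ x - φ y) * K x y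

/-- `u` is a weak solution of `E_K(u,·) = f` in `Ω`. -/
def IsSolution (Ω : Set (V n)) (K : V n → V n → ℝ) (u f : V n → ℝ) : Prop :=
  ∀ φ : V n → ℝ, MemX0 Ω K φ → energyForm K u φ = ∫ x in Ω, f x * φ x

/-- Symmetry of the kernel. -/
def KSym (K : V n → V n → ℝ) : Prop :=
  ∀ᵐ p ∂(volume : Measure (V n × V n)), K p.1 p.2 = K p.2 p.1

/-- Growth conditions (i) and (ii) on the kernel. -/
def KBounds (s β lam Lam M : ℝ) (K : V n → V n → ℝ) : Prop :=
  (∀ᵐ p ∂(volume : Measure (V n × V n)), ‖p.1 - p.2‖ < 1 →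
      lam ≤ ‖p.1 - p.2‖ ^ ((n : ℝ) + 2 * s) * K p.1 p.2 ∧
        ‖p.1 - p.2‖ ^ ((n : ℝ) + 2 * s) * K p.1 p.2 ≤ Lam) ∧
  ∀ᵐ p ∂(volume : Measure (V n × V n)), 1 ≤ ‖p.1 - p.2‖ →
      0 ≤ ‖p.1 - p.2‖ ^ ((n : ℝ) + β) * K p.1 p.2 ∧
        ‖p.1 - p.2‖ ^ ((n : ℝ) + β) * K p.1 p.2 ≤ M

/-- Hölder condition (iii) on the kernel (local translation regularity). -/
def KHolder (s Gam : ℝ) (K : V n → V n → ℝ) : Prop :=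
  ∀ᵐ q ∂(volume : Measure (V n × V n × V n)),
    ‖q.2.1 - q.2.2‖ < 1 → ‖q.1‖ < 1 →
      ‖q.2.1 - q.2.2‖ ^ ((n : ℝ) + 2 * s) *
          |K (q.2.1 + q.1) (q.2.2 + q.1) - K q.2.1 q.2.2| ≤ Gam * ‖q.1‖ ^ s

/-- The `L²` norm over a set `A`. -/
def L2norm (A : Set (V n)) (u : V n → ℝ) : ℝ := (∫ x in A, u x ^ 2) ^ ((1 : ℝ) / 2)

/-- The weighted norm `‖u‖_{L¹_{x₀,β}(ℝⁿ)}`. -/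
def wnorm (β : ℝ) (x₀ : V n) (u : V n → ℝ) : ℝ :=
  ∫ x, |u x| / (1 + ‖x - x₀‖ ^ ((n : ℝ) + β))

/-- Finiteness of the weighted norm `‖u‖_{L¹_{x₀,β}(ℝⁿ)}`. -/
def HasFiniteWnorm (β : ℝ) (x₀ : V n) (u : V n → ℝ) : Prop :=
  Integrable (fun x => |u x| / (1 + ‖x - x₀‖ ^ ((n : ℝ) + β)))

/-- The second difference `Δ_z² u(x) = u(x+2z) − 2u(x+z) + u(x)`. -/
def diff2 (z : V n) (u : V n → ℝ) (x : V n) : ℝ := u (x + 2 • z) - 2 * u (x + z) + u x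

/-- The set `U_{2z} = {x ∈ U : x+z ∈ U, x+2z ∈ U}`. -/
def shift2 (U : Set (V n)) (z : V n) : Set (V n) := {x ∈ U | x + z ∈ U ∧ x + 2 • z ∈ U}

/-- The fractional kernel `|z|^{-n-2s}` truncated to the ball of radius `δ`. -/
def nearKernel (s δ : ℝ) (z : V n) : ℝ := if ‖z‖ < δ then ‖z‖ ^ (-((n : ℝ) + 2 * s)) else 0

/-- The squared truncated Gagliardo seminorm. -/
def gagliardoSq (s δ : ℝ) (φ : V n → ℝ) : ℝ :=
  ∫ p : V n × V n, (φ p.1 - φ p.2) ^ 2 * nearKernel s δ (p.1 - p.2)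

/-- Measurable functions of finite `L²` norm and finite truncated Gagliardo seminorm. -/
structure MemHs (s δ : ℝ) (φ : V n → ℝ) : Prop where
  measurable : Measurable φ
  integrable_sq : Integrable (fun x => φ x ^ 2)
  integrable_gagliardo :
    Integrable (fun p : V n × V n => (φ p.1 - φ p.2) ^ 2 * nearKernel s δ (p.1 - p.2))

lemma nearKernel_nonneg (s δ : ℝ) (z : V n) : 0 ≤ nearKernel s δ z := by
  unfold nearKernel
  split_ifs <;> positivity

lemma nearKernel_neg (s δ : ℝ) (z : V n) : nearKernel s δ (-z) = nearKernel s δ z := by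
  simp [nearKernel]

lemma nearKernel_of_le {s δ : ℝ} {z : V n} (h : δ ≤ ‖z‖) : nearKernel s δ z = 0 := by
  simp [nearKernel, h]

@[fun_prop]
lemma measurable_nearKernel (s δ : ℝ) : Measurable (nearKernel (n := n) s δ) := by
  unfold nearKernel
  exact Measurable.ite (measurableSet_lt measurable_norm measurable_const)
    (measurable_norm.pow_const _) measurable_const

lemma gagliardoSq_nonneg (s δ : ℝ) (φ : V n → ℝ) : 0 ≤ gagliardoSq s δ φ :=
  integral_nonneg fun _ => mul_nonneg (sq_nonneg _) (nearKernel_nonneg _ _ _)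

lemma finrank_V (n : ℕ) : Module.finrank ℝ (V n) = n := by simp

lemma integrable_sq_mul_nearKernel (hn : 1 ≤ n) {s : ℝ} (hs : s < 1) (δ : ℝ) :
    Integrable (fun z : V n => ‖z‖ ^ 2 * nearKernel s δ z) := by
  have h : IntegrableOn (fun z : V n => ‖z‖ ^ 2 * ‖z‖ ^ (-((n : ℝ) + 2 * s))) (ball 0 δ) := by
    refine integrableOn_ball_of_norm_le_rpow (C := 1) (α := n + 2 * s - 2) (by simpa using hn)
      (by simp; linarith) (ae_of_all _ fun x => ?_) (by fun_prop)
    rcases eq_or_ne x 0 with rfl | hx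
    · simp; positivity
    · have hx : 0 < ‖x‖ := norm_pos_iff.2 hx
      rw [Real.norm_of_nonneg (by positivity), ← Real.rpow_natCast, ← Real.rpow_add hx, one_mul]
      apply le_of_eq; congr 1; push_cast; ring
  rw [← integrable_indicator_iff measurableSet_ball] at h
  refine h.congr (ae_of_all _ fun z => ?_)
  by_cases hz : ‖z‖ < δ <;> simp [nearKernel, hz, indicator]

/-! ### Change of variables on the product -/

lemma integrable_mul_sub_fst {g κ : V n → ℝ} (hg : Integrable g) (hκ : Integrable κ) :
    Integrable (fun p : V n × V n => g p.2 * κ (p.1 - p.2)) := by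
  have h := (measurePreserving_sub_prod (volume : Measure (V n)) (volume : Measure (V n)))
  have h2 := h.integrable_comp_of_integrable (hκ.mul_prod hg)
  exact h2.congr (ae_of_all _ fun p => by simp [mul_comm])

lemma integral_mul_sub_fst (g κ : V n → ℝ) (hg : Integrable g) (hκ : Integrable κ) :
    ∫ p : V n × V n, g p.2 * κ (p.1 - p.2) = (∫ x, g x) * ∫ z, κ z := by
  have h := (measurePreserving_sub_prod (volume : Measure (V n)) (volume : Measure (V n)))
  have h1 := integral_map (μ := (volume : Measure (V n)).prod (volume : Measure (V n)))
    h.measurable.aemeasurable (f := fun p : V n × V n => κ p.1 * g p.2)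
    (by rw [h.map_eq]; exact (hκ.mul_prod hg).aestronglyMeasurable)
  rw [h.map_eq, integral_prod_mul] at h1
  rw [mul_comm, h1]
  exact integral_congr_ae (ae_of_all _ fun p => by simp [mul_comm])

lemma integrable_swap {F : V n × V n → ℝ} (hF : Integrable F) :
    Integrable (fun p : V n × V n => F (p.2, p.1)) := hF.swap

lemma integral_swap (F : V n × V n → ℝ) :
    ∫ p : V n × V n, F (p.2, p.1) = ∫ p, F p :=
  integral_prod_swap F

lemma integrable_mul_sub_snd {g κ : V n → ℝ} (hg : Integrable g) (hκ : Integrable κ)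
    (he : ∀ z, κ (-z) = κ z) :
    Integrable (fun p : V n × V n => g p.1 * κ (p.1 - p.2)) := by
  refine (integrable_swap (integrable_mul_sub_fst hg hκ)).congr (ae_of_all _ fun p => ?_)
  simp only
  rw [← he, neg_sub]

lemma integral_mul_sub_snd (g κ : V n → ℝ) (hg : Integrable g) (hκ : Integrable κ)
    (he : ∀ z, κ (-z) = κ z) :
    ∫ p : V n × V n, g p.1 * κ (p.1 - p.2) = (∫ x, g x) * ∫ z, κ z := by
  rw [← integral_mul_sub_fst g κ hg hκ, ← integral_swap]
  refine integral_congr_ae (ae_of_all _ fun p => ?_)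
  simp only
  rw [← he, neg_sub]

lemma integrable_prod_translate {F : V n × V n → ℝ} (hF : Integrable F) (a b : V n) :
    Integrable (fun p : V n × V n => F (p.1 + a, p.2 + b)) :=
  ((measurePreserving_add_right (volume : Measure (V n)) a).prod
    (measurePreserving_add_right (volume : Measure (V n)) b)).integrable_comp_of_integrable hF

lemma integral_prod_translate (F : V n × V n → ℝ) (a b : V n) :
    ∫ p : V n × V n, F (p.1 + a, p.2 + b) = ∫ p, F p :=
  ((measurePreserving_add_right (volume : Measure (V n)) a).prod
    (measurePreserving_add_right (volume : Measure (V n)) b)).integral_comp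
    ((measurableEmbedding_addRight a).prodMap (measurableEmbedding_addRight b)) F

lemma MemHs.translate {s δ : ℝ} {φ : V n → ℝ} (h : MemHs s δ φ) (a : V n) :
    MemHs s δ (fun x => φ (x + a)) where
  measurable := h.measurable.comp (measurable_id.add_const a)
  integrable_sq := h.integrable_sq.comp_add_right a
  integrable_gagliardo := by
    have := integrable_prod_translate h.integrable_gagliardo a a
    simpa using this

lemma gagliardoSq_translate (s δ : ℝ) (φ : V n → ℝ) (a : V n) :
    gagliardoSq s δ (fun x => φ (x + a)) = gagliardoSq s δ φ := by
  unfold gagliardoSq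
  rw [← integral_prod_translate
    (fun p => (φ p.1 - φ p.2) ^ 2 * nearKernel s δ (p.1 - p.2)) a a]
  simp

lemma MemHs.sub {s δ : ℝ} {φ ψ : V n → ℝ} (h : MemHs s δ φ) (h' : MemHs s δ ψ) :
    MemHs s δ (fun x => φ x - ψ x) where
  measurable := h.measurable.sub h'.measurable
  integrable_sq := by
    refine ((h.integrable_sq.add h'.integrable_sq).const_mul 2).mono'
      (((h.measurable.sub h'.measurable).pow_const 2).aestronglyMeasurable)
      (ae_of_all _ fun x => ?_)
    rw [Real.norm_of_nonneg (sq_nonneg _)]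
    simp only [Pi.add_apply]
    nlinarith [sq_nonneg (φ x + ψ x)]
  integrable_gagliardo := by
    have hm := h.measurable
    have hm' := h'.measurable
    refine ((h.integrable_gagliardo.add h'.integrable_gagliardo).const_mul 2).mono'
      (by fun_prop) (ae_of_all _ fun p => ?_)
    have hk := nearKernel_nonneg s δ (p.1 - p.2)
    rw [Real.norm_of_nonneg (mul_nonneg (sq_nonneg _) hk)]
    simp only [Pi.add_apply]
    rw [← add_mul, ← mul_assoc]
    refine mul_le_mul_of_nonneg_right ?_ hk
    nlinarith [sq_nonneg (φ p.1 + ψ p.1 - φ p.2 - ψ p.2)]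

/-- Multiplication by a bounded Lipschitz cutoff `η`, with a majorant `G` for the part of the
seminorm seen by `η`. -/
lemma memHs_mul (hn : 1 ≤ n) {s δ ℓ : ℝ} (hs : s < 1) {η w : V n → ℝ}
    (hη : Measurable η) (hη1 : ∀ x, |η x| ≤ 1)
    (hℓ : ∀ x y, (η x - η y) ^ 2 ≤ ℓ ^ 2 * ‖x - y‖ ^ 2)
    (hw : Measurable w) (hw2 : Integrable (fun x => w x ^ 2)) {G : V n × V n → ℝ}
    (hG : Integrable G)
    (hGle : ∀ᵐ p : V n × V n, η p.1 ^ 2 * (w p.1 - w p.2) ^ 2 * nearKernel s δ (p.1 - p.2) ≤ G p) :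
    MemHs s δ (fun x => η x * w x) ∧
      gagliardoSq s δ (fun x => η x * w x) ≤
        2 * (∫ p, G p) +
          2 * (ℓ ^ 2 * (∫ x, w x ^ 2) * ∫ z : V n, ‖z‖ ^ 2 * nearKernel s δ z) := by
  have hI := integrable_sq_mul_nearKernel hn hs δ
  have hB := integrable_mul_sub_fst hw2 hI
  have hle : ∀ᵐ p : V n × V n,
      (η p.1 * w p.1 - η p.2 * w p.2) ^ 2 * nearKernel s δ (p.1 - p.2) ≤
      2 * G p + 2 * (ℓ ^ 2 * (w p.2 ^ 2 * (‖p.1 - p.2‖ ^ 2 * nearKernel s δ (p.1 - p.2)))) := by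
    filter_upwards [hGle] with p hp
    have hk := nearKernel_nonneg s δ (p.1 - p.2)
    have h1 := hℓ p.1 p.2
    have h2 : (η p.1 * w p.1 - η p.2 * w p.2) ^ 2 ≤
        2 * (η p.1 ^ 2 * (w p.1 - w p.2) ^ 2) + 2 * (w p.2 ^ 2 * (η p.1 - η p.2) ^ 2) := by
      nlinarith [sq_nonneg (η p.1 * (w p.1 - w p.2) - w p.2 * (η p.1 - η p.2))]
    have h3 : w p.2 ^ 2 * (η p.1 - η p.2) ^ 2 ≤ w p.2 ^ 2 * (ℓ ^ 2 * ‖p.1 - p.2‖ ^ 2) :=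
      mul_le_mul_of_nonneg_left h1 (sq_nonneg _)
    calc _ ≤ (2 * (η p.1 ^ 2 * (w p.1 - w p.2) ^ 2) +
          2 * (w p.2 ^ 2 * (ℓ ^ 2 * ‖p.1 - p.2‖ ^ 2))) * nearKernel s δ (p.1 - p.2) :=
          mul_le_mul_of_nonneg_right (by linarith) hk
      _ ≤ _ := by linarith
  have hInt := (hG.const_mul 2).add ((hB.const_mul (ℓ ^ 2)).const_mul 2)
  have hS : Integrable (fun p : V n × V n =>
      (η p.1 * w p.1 - η p.2 * w p.2) ^ 2 * nearKernel s δ (p.1 - p.2)) := by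
    refine hInt.mono' (by fun_prop) ?_
    filter_upwards [hle] with p hp
    rwa [Real.norm_of_nonneg (mul_nonneg (sq_nonneg _) (nearKernel_nonneg _ _ _))]
  refine ⟨⟨hη.mul hw, ?_, hS⟩, ?_⟩
  · refine hw2.mono' (by fun_prop) (ae_of_all _ fun x => ?_)
    rw [Real.norm_of_nonneg (sq_nonneg _), mul_pow]
    have := (sq_le_one_iff_abs_le_one _).2 (hη1 x)
    nlinarith [sq_nonneg (w x)]
  · refine (integral_mono_ae hS hInt hle).trans (le_of_eq ?_)
    have h := integral_mul_sub_fst _ _ hw2 hI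
    rw [integral_add' (hG.const_mul 2) ((hB.const_mul (ℓ ^ 2)).const_mul 2),
      integral_const_mul, integral_const_mul, integral_const_mul]
    rw [h]; ring

/-- Multiplication of a `MemHs` function by a bounded Lipschitz cutoff. -/
lemma MemHs.cutoff_mul (hn : 1 ≤ n) {s δ ℓ : ℝ} (hs : s < 1) {η w : V n → ℝ}
    (hη : Measurable η) (hη1 : ∀ x, |η x| ≤ 1)
    (hℓ : ∀ x y, (η x - η y) ^ 2 ≤ ℓ ^ 2 * ‖x - y‖ ^ 2) (hw : MemHs s δ w) :
    MemHs s δ (fun x => η x * w x) ∧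
      gagliardoSq s δ (fun x => η x * w x) ≤ 2 * gagliardoSq s δ w +
          2 * (ℓ ^ 2 * (∫ x, w x ^ 2) * ∫ z : V n, ‖z‖ ^ 2 * nearKernel s δ z) := by
  refine memHs_mul hn hs hη hη1 hℓ hw.measurable hw.integrable_sq hw.integrable_gagliardo
    (ae_of_all _ fun p => ?_)
  have hk := nearKernel_nonneg s δ (p.1 - p.2)
  have := (sq_le_one_iff_abs_le_one _).2 (hη1 p.1)
  rw [mul_assoc]
  exact mul_le_of_le_one_left (mul_nonneg (sq_nonneg _) hk) this

lemma le_rpow_mul_nearKernel {s δ r A : ℝ} (hs : 0 < s) (hr : r ≤ δ) (hA : 0 ≤ A)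
    {z : V n} (hz : ‖z‖ < r) (h0 : z = 0 → A = 0) :
    A ≤ r ^ ((n : ℝ) + 2 * s) * (A * nearKernel s δ z) := by
  by_cases hz0 : z = 0
  · simp [h0 hz0]
  · have hz' : 0 < ‖z‖ := norm_pos_iff.2 hz0
    have hr0 : 0 < r := hz'.trans hz
    rw [nearKernel, if_pos (hz.trans_le hr), Real.rpow_neg hz'.le]
    have h1 : ‖z‖ ^ ((n : ℝ) + 2 * s) ≤ r ^ ((n : ℝ) + 2 * s) :=
      Real.rpow_le_rpow hz'.le hz.le (by positivity)
    have h2 : 0 < ‖z‖ ^ ((n : ℝ) + 2 * s) := by positivity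
    rw [← mul_assoc, mul_comm _ A, mul_assoc]
    refine le_mul_of_one_le_right hA ?_
    rwa [← div_eq_mul_inv, one_le_div h2]

/-- The constant in `integral_sq_translate_sub_le`. -/
def translateConst (n : ℕ) (s : ℝ) : ℝ :=
  4 * 2 ^ ((n : ℝ) + 2 * s) / volume.real (ball (0 : V n) 1)

lemma volume_real_unitBall_pos (n : ℕ) : 0 < volume.real (ball (0 : V n) 1) :=
  ENNReal.toReal_pos (measure_ball_pos _ _ one_pos).ne' measure_ball_lt_top.ne

lemma translateConst_pos (n : ℕ) (s : ℝ) : 0 < translateConst n s :=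
  div_pos (by positivity) (volume_real_unitBall_pos n)

/-- Translations of a function with finite Gagliardo seminorm are Hölder continuous in `L²`. -/
lemma integral_sq_translate_sub_le {s δ : ℝ} (hs : 0 < s) {φ : V n → ℝ}
    (hφ : MemHs s δ φ) {h : V n} (h0 : h ≠ 0) (hδ : 2 * ‖h‖ ≤ δ) :
    ∫ x, (φ (x + h) - φ x) ^ 2 ≤
      translateConst n s * ‖h‖ ^ (2 * s) * gagliardoSq s δ φ := by
  have hr : 0 < ‖h‖ := norm_pos_iff.2 h0
  set r := ‖h‖ with hrdef
  set κ : V n → ℝ := (ball (0 : V n) r).indicator (fun _ => 1) with hκ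
  have hκi : Integrable κ := by
    rw [hκ, integrable_indicator_iff measurableSet_ball]
    exact integrableOn_const measure_ball_lt_top.ne
  have hκe : ∀ z, κ (-z) = κ z := fun z => by simp [hκ, indicator]
  have hκI : ∫ z, κ z = r ^ n * volume.real (ball (0 : V n) 1) := by
    rw [hκ, integral_indicator measurableSet_ball]
    simp [measureReal_def, Measure.addHaar_ball_of_pos _ (0 : V n) hr, hr.le]
  have hg := ((hφ.translate h).sub hφ).integrable_sq
  have e := integral_mul_sub_snd _ κ hg hκi hκe
  have hi := integrable_mul_sub_snd hg hκi hκe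
  set F : V n × V n → ℝ := fun p => (φ p.1 - φ p.2) ^ 2 * nearKernel s δ (p.1 - p.2) with hF
  have hFi : Integrable F := hφ.integrable_gagliardo
  have hFt := integrable_prod_translate hFi h 0
  have hIt := integral_prod_translate F h 0
  set q := (n : ℝ) + 2 * s with hq
  have hle : ∀ p : V n × V n, (φ (p.1 + h) - φ p.1) ^ 2 * κ (p.1 - p.2) ≤
      2 * (2 * r) ^ q * (F (p.1 + h, p.2 + 0) + F p) := by
    rintro ⟨x, y⟩
    by_cases hxy : ‖x - y‖ < r
    · have hk : κ (x - y) = 1 := by simp [hκ, hxy]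
      have h1 := le_rpow_mul_nearKernel (s := s) (δ := δ) (r := 2 * r) hs hδ
        (sq_nonneg (φ (x + h) - φ y)) (z := x + h - y)
        (by
          have : x + h - y = (x - y) + h := by abel
          rw [this]; exact (norm_add_le _ _).trans_lt (by linarith))
        (fun hz => by simp [sub_eq_zero.1 hz])
      have h2 := le_rpow_mul_nearKernel (s := s) (δ := δ) (r := 2 * r) hs hδ
        (sq_nonneg (φ x - φ y)) (z := x - y) (by linarith)
        (fun hz => by simp [sub_eq_zero.1 hz])
      simp only [hF, hk, mul_one, add_zero]
      nlinarith [sq_nonneg (φ (x + h) - φ y + (φ x - φ y))]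
    · have hk : κ (x - y) = 0 := by simp [hκ, hxy]
      have hFn : ∀ p, 0 ≤ F p := fun p => mul_nonneg (sq_nonneg _) (nearKernel_nonneg _ _ _)
      simp only [hk, mul_zero]
      have := hFn (x + h, y + 0)
      have := hFn (x, y)
      positivity
  have hmono := integral_mono hi ((hFt.add hFi).const_mul _) hle
  rw [e, hκI, integral_const_mul, integral_add' hFt hFi, hIt] at hmono
  have hS : ∫ p, F p = gagliardoSq s δ φ := rfl
  rw [hS] at hmono
  have hB := volume_real_unitBall_pos n
  have hpow : (2 * r) ^ q = 2 ^ q * (r ^ n * r ^ (2 * s)) := by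
    rw [Real.mul_rpow (by norm_num) hr.le, hq, Real.rpow_add hr, Real.rpow_natCast]
  rw [hpow] at hmono
  have hrn : 0 < r ^ n * volume.real (ball (0 : V n) 1) := by positivity
  rw [← le_div_iff₀ hrn] at hmono
  refine hmono.trans (le_of_eq ?_)
  unfold translateConst
  field_simp
  ring

lemma sq_integral_mul_mul_le {α : Type*} [MeasurableSpace α] {μ : Measure α} {f g q : α → ℝ}
    (hq : ∀ x, 0 ≤ q x) (hf : Integrable (fun x => f x ^ 2 * q x) μ)
    (hg : Integrable (fun x => g x ^ 2 * q x) μ) (hfg : Integrable (fun x => f x * g x * q x) μ) :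
    (∫ x, f x * g x * q x ∂μ) ^ 2 ≤ (∫ x, f x ^ 2 * q x ∂μ) * ∫ x, g x ^ 2 * q x ∂μ := by
  have key : ∀ t : ℝ, 0 ≤ (∫ x, f x ^ 2 * q x ∂μ) * (t * t) +
      (-2 * ∫ x, f x * g x * q x ∂μ) * t + ∫ x, g x ^ 2 * q x ∂μ := by
    intro t
    have h0 : 0 ≤ ∫ x, (t * f x - g x) ^ 2 * q x ∂μ :=
      integral_nonneg fun x => mul_nonneg (sq_nonneg _) (hq x)
    have e : ∫ x, (t * f x - g x) ^ 2 * q x ∂μ =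
        ∫ x, ((t * t) * (f x ^ 2 * q x) + (-2 * t) * (f x * g x * q x) + g x ^ 2 * q x) ∂μ :=
      integral_congr_ae (ae_of_all _ fun x => by simp only; ring)
    have hs : Integrable (fun x => (t * t) * (f x ^ 2 * q x) + (-2 * t) * (f x * g x * q x)) μ :=
      (hf.const_mul _).add (hfg.const_mul _)
    rw [e, integral_add hs hg,
      integral_add (hf.const_mul _) (hfg.const_mul _), integral_const_mul,
      integral_const_mul] at h0
    linarith
  have := discrim_le_zero key
  unfold discrim at this
  nlinarith

/-- The bilinear form of a kernel as an integral over the product space. -/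
def kernelForm (k : V n × V n → ℝ) (u φ : V n → ℝ) : ℝ :=
  ∫ p : V n × V n, (u p.1 - u p.2) * (φ p.1 - φ p.2) * k p

lemma integrable_kernelForm {s δ c : ℝ} {u φ : V n → ℝ} (hu : MemHs s δ u)
    (hφ : MemHs s δ φ) {k : V n × V n → ℝ} (hk : Measurable k)
    (hkc : ∀ᵐ p : V n × V n, |k p| ≤ c * nearKernel s δ (p.1 - p.2)) :
    Integrable (fun p : V n × V n => (u p.1 - u p.2) * (φ p.1 - φ p.2) * k p) := by
  have hm := hu.measurable
  have hm' := hφ.measurable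
  refine ((hu.integrable_gagliardo.add hφ.integrable_gagliardo).const_mul c).mono'
    (by fun_prop) ?_
  filter_upwards [hkc] with p hp
  rw [Real.norm_eq_abs, abs_mul]
  simp only [Pi.add_apply]
  have h1 : |(u p.1 - u p.2) * (φ p.1 - φ p.2)| ≤ (u p.1 - u p.2) ^ 2 + (φ p.1 - φ p.2) ^ 2 := by
    rw [abs_le]; constructor <;>
    nlinarith [sq_nonneg (u p.1 - u p.2 + (φ p.1 - φ p.2)),
      sq_nonneg (u p.1 - u p.2 - (φ p.1 - φ p.2)), sq_nonneg (u p.1 - u p.2),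
      sq_nonneg (φ p.1 - φ p.2)]
  calc _ ≤ ((u p.1 - u p.2) ^ 2 + (φ p.1 - φ p.2) ^ 2) * (c * nearKernel s δ (p.1 - p.2)) :=
        mul_le_mul h1 hp (abs_nonneg _) (by positivity)
    _ = _ := by ring

/-- Cauchy–Schwarz for a form whose kernel is dominated by the truncated fractional kernel. -/
lemma abs_kernelForm_le {s δ c : ℝ} (hc : 0 ≤ c) {u φ : V n → ℝ} (hu : MemHs s δ u)
    (hφ : MemHs s δ φ) {k : V n × V n → ℝ} (hk : Measurable k)
    (hkc : ∀ᵐ p : V n × V n, |k p| ≤ c * nearKernel s δ (p.1 - p.2)) :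
    |kernelForm k u φ| ≤ c * √(gagliardoSq s δ u * gagliardoSq s δ φ) := by
  have hm := hu.measurable
  have hm' := hφ.measurable
  have hi := (integrable_kernelForm hu hφ hk hkc).abs
  have hi2 : Integrable (fun p : V n × V n =>
      |u p.1 - u p.2| * |φ p.1 - φ p.2| * nearKernel s δ (p.1 - p.2)) := by
    refine (integrable_kernelForm hu hφ (k := fun p => nearKernel s δ (p.1 - p.2)) (c := 1)
      (by fun_prop) (ae_of_all _ fun p => ?_)).abs.congr (ae_of_all _ fun p => ?_)
    · rw [abs_of_nonneg (nearKernel_nonneg _ _ _), one_mul]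
    · simp only [abs_mul, abs_of_nonneg (nearKernel_nonneg s δ (p.1 - p.2))]
  have h1 : |kernelForm k u φ| ≤ c * ∫ p : V n × V n,
      |u p.1 - u p.2| * |φ p.1 - φ p.2| * nearKernel s δ (p.1 - p.2) := by
    rw [← integral_const_mul]
    refine abs_integral_le_integral_abs.trans (integral_mono_ae hi (hi2.const_mul c) ?_)
    filter_upwards [hkc] with p hp
    simp only [abs_mul]
    calc _ ≤ |u p.1 - u p.2| * |φ p.1 - φ p.2| * (c * nearKernel s δ (p.1 - p.2)) := by gcongr
      _ = _ := by ring
  refine h1.trans (mul_le_mul_of_nonneg_left (Real.le_sqrt_of_sq_le ?_) hc)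
  have := sq_integral_mul_mul_le (μ := volume) (f := fun p : V n × V n => |u p.1 - u p.2|)
    (g := fun p => |φ p.1 - φ p.2|) (q := fun p => nearKernel s δ (p.1 - p.2))
    (fun p => nearKernel_nonneg _ _ _) (by simpa using hu.integrable_gagliardo)
    (by simpa using hφ.integrable_gagliardo) hi2
  simpa [gagliardoSq] using this

/-- Caccioppoli-type identity and estimate: testing with `η² w` controls the energy of `η w`. -/
lemma mul_gagliardoSq_cutoff_le (hn : 1 ≤ n) {s δ ℓ lam Lam : ℝ} (hs : s < 1)
    {η w : V n → ℝ} (hη : Measurable η)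
    (hℓ : ∀ x y, (η x - η y) ^ 2 ≤ ℓ ^ 2 * ‖x - y‖ ^ 2)
    (hw : Measurable w) (hw2 : Integrable (fun x => w x ^ 2))
    (hηw : MemHs s δ (fun x => η x * w x))
    {k : V n × V n → ℝ} (hk : Measurable k)
    (hklow : ∀ᵐ p : V n × V n, lam * nearKernel s δ (p.1 - p.2) ≤ k p)
    (hkc : ∀ᵐ p : V n × V n, |k p| ≤ Lam * nearKernel s δ (p.1 - p.2)) :
    lam * gagliardoSq s δ (fun x => η x * w x) ≤
      kernelForm k w (fun x => η x ^ 2 * w x) +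
        Lam * (ℓ ^ 2 * (∫ x, w x ^ 2) * ∫ z : V n, ‖z‖ ^ 2 * nearKernel s δ z) := by
  have hI := integrable_sq_mul_nearKernel hn hs δ
  have he : ∀ z : V n, ‖-z‖ ^ 2 * nearKernel s δ (-z) = ‖z‖ ^ 2 * nearKernel s δ z := fun z => by
    rw [norm_neg, nearKernel_neg]
  have hA := integrable_mul_sub_snd hw2 hI he
  have hB := integrable_mul_sub_fst hw2 hI
  have eA := integral_mul_sub_snd _ _ hw2 hI he
  have eB := integral_mul_sub_fst _ _ hw2 hI
  have hE := integrable_kernelForm hηw hηw hk hkc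
  have hD : ∀ᵐ p : V n × V n, ‖w p.1 * w p.2 * (η p.1 - η p.2) ^ 2 * k p‖ ≤
      Lam * ℓ ^ 2 / 2 * (w p.1 ^ 2 * (‖p.1 - p.2‖ ^ 2 * nearKernel s δ (p.1 - p.2)) +
        w p.2 ^ 2 * (‖p.1 - p.2‖ ^ 2 * nearKernel s δ (p.1 - p.2))) := by
    filter_upwards [hkc] with p hp
    rw [Real.norm_eq_abs, abs_mul, abs_mul, abs_of_nonneg (sq_nonneg (η p.1 - η p.2))]
    have h1 : |w p.1 * w p.2| ≤ (w p.1 ^ 2 + w p.2 ^ 2) / 2 := by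
      rw [abs_le]; constructor <;>
      nlinarith [sq_nonneg (w p.1 + w p.2), sq_nonneg (w p.1 - w p.2)]
    calc _ ≤ (w p.1 ^ 2 + w p.2 ^ 2) / 2 * (ℓ ^ 2 * ‖p.1 - p.2‖ ^ 2) *
          (Lam * nearKernel s δ (p.1 - p.2)) := by
          have := hℓ p.1 p.2
          gcongr
      _ = _ := by ring
  have hDi : Integrable (fun p : V n × V n => w p.1 * w p.2 * (η p.1 - η p.2) ^ 2 * k p) :=
    ((hA.add hB).const_mul _).mono' (by fun_prop) hD
  have e : kernelForm k w (fun x => η x ^ 2 * w x) =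
      (∫ p : V n × V n, (η p.1 * w p.1 - η p.2 * w p.2) * (η p.1 * w p.1 - η p.2 * w p.2) * k p) -
      ∫ p : V n × V n, w p.1 * w p.2 * (η p.1 - η p.2) ^ 2 * k p := by
    rw [← integral_sub hE hDi]
    refine integral_congr_ae (ae_of_all _ fun p => ?_)
    simp only; ring
  have h1 : lam * gagliardoSq s δ (fun x => η x * w x) ≤
      ∫ p : V n × V n, (η p.1 * w p.1 - η p.2 * w p.2) * (η p.1 * w p.1 - η p.2 * w p.2) * k p := by
    unfold gagliardoSq
    rw [← integral_const_mul]
    refine integral_mono_ae (hηw.integrable_gagliardo.const_mul _) hE ?_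
    filter_upwards [hklow] with p hp
    nlinarith [mul_le_mul_of_nonneg_left hp (sq_nonneg (η p.1 * w p.1 - η p.2 * w p.2))]
  have h2 := (norm_integral_le_of_norm_le ((hA.add hB).const_mul (Lam * ℓ ^ 2 / 2)) hD)
  rw [integral_const_mul, integral_add' hA hB, eA, eB, Real.norm_eq_abs] at h2
  have h3 := le_abs_self (∫ p : V n × V n, w p.1 * w p.2 * (η p.1 - η p.2) ^ 2 * k p)
  linarith

/-- Translation of the test function in a kernel form: the discrete integration by parts. -/
lemma kernelForm_translate_sub {s δ c d : ℝ} {v ψ : V n → ℝ} (hv : MemHs s δ v)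
    (hψ : MemHs s δ ψ) {k : V n × V n → ℝ} (hk : Measurable k) (h : V n)
    (hkc : ∀ᵐ p : V n × V n, |k p| ≤ c * nearKernel s δ (p.1 - p.2))
    (hkh : ∀ᵐ p : V n × V n, |k (p.1 + h, p.2 + h) - k p| ≤ d * nearKernel s δ (p.1 - p.2)) :
    kernelForm k (fun x => v (x + h) - v x) ψ =
      kernelForm k v (fun x => ψ (x + -h) - ψ x) -
        kernelForm (fun p => k (p.1 + h, p.2 + h) - k p) (fun x => v (x + h)) ψ := by
  have hvh := hv.translate h
  have hψh := hψ.translate (-h)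
  have hkm : Measurable (fun p : V n × V n => k (p.1 + h, p.2 + h)) := by fun_prop
  have hkhc : ∀ᵐ p : V n × V n, |k (p.1 + h, p.2 + h)| ≤ (c + d) * nearKernel s δ (p.1 - p.2) := by
    filter_upwards [hkc, hkh] with p h1 h2
    have := abs_add_le (k p) (k (p.1 + h, p.2 + h) - k p)
    rw [add_sub_cancel] at this
    linarith
  have e1 : kernelForm k (fun x => v (x + h) - v x) ψ =
      kernelForm k (fun x => v (x + h)) ψ - kernelForm k v ψ := by
    unfold kernelForm
    rw [← integral_sub (integrable_kernelForm hvh hψ hk hkc) (integrable_kernelForm hv hψ hk hkc)]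
    exact integral_congr_ae (ae_of_all _ fun p => by simp only; ring)
  have e2 : kernelForm k v (fun x => ψ (x + -h) - ψ x) =
      kernelForm k v (fun x => ψ (x + -h)) - kernelForm k v ψ := by
    unfold kernelForm
    rw [← integral_sub (integrable_kernelForm hv hψh hk hkc) (integrable_kernelForm hv hψ hk hkc)]
    exact integral_congr_ae (ae_of_all _ fun p => by simp only; ring)
  have e3 : kernelForm (fun p => k (p.1 + h, p.2 + h) - k p) (fun x => v (x + h)) ψ =
      kernelForm (fun p => k (p.1 + h, p.2 + h)) (fun x => v (x + h)) ψ -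
        kernelForm k (fun x => v (x + h)) ψ := by
    unfold kernelForm
    rw [← integral_sub (integrable_kernelForm hvh hψ hkm hkhc)
      (integrable_kernelForm hvh hψ hk hkc)]
    exact integral_congr_ae (ae_of_all _ fun p => by simp only; ring)
  have e4 : kernelForm (fun p => k (p.1 + h, p.2 + h)) (fun x => v (x + h)) ψ =
      kernelForm k v (fun x => ψ (x + -h)) := by
    unfold kernelForm
    rw [← integral_prod_translate
      (fun p => (v p.1 - v p.2) * (ψ (p.1 + -h) - ψ (p.2 + -h)) * k p) h h]
    simp
  rw [e1, e2, e3, e4]; ring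

set_option maxHeartbeats 1000000 in
/-- The translation estimate: a function whose kernel form acts boundedly in `L²` on test
functions supported in `U` has second differences of order `|h|^{2s}` in `L²`. -/
lemma exists_second_difference_bound (hn : 1 ≤ n) {s : ℝ} (hs0 : 0 < s) (hs : s < 1)
    {lam Lam Gam : ℝ} (hlam : 0 < lam) (hLam : 0 ≤ Lam) (hGam : 0 ≤ Gam) (δ ℓ : ℝ) :
    ∃ C, 0 ≤ C ∧ ∀ (v η : V n → ℝ) (k : V n × V n → ℝ) (U : Set (V n)) (h : V n) (N : ℝ),
      0 ≤ N → MemHs s δ v → gagliardoSq s δ v ≤ N ^ 2 →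
      Measurable η → (∀ x, |η x| ≤ 1) → (∀ x y, (η x - η y) ^ 2 ≤ ℓ ^ 2 * ‖x - y‖ ^ 2) →
      (∀ x, η x ≠ 0 → x ∈ U ∧ x + h ∈ U) →
      h ≠ 0 → 2 * ‖h‖ ≤ δ → Measurable k →
      (∀ᵐ p : V n × V n, lam * nearKernel s δ (p.1 - p.2) ≤ k p) →
      (∀ᵐ p : V n × V n, |k p| ≤ Lam * nearKernel s δ (p.1 - p.2)) →
      (∀ᵐ p : V n × V n, |k (p.1 + h, p.2 + h) - k p| ≤
        Gam * ‖h‖ ^ s * nearKernel s δ (p.1 - p.2)) →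
      (∀ φ : V n → ℝ, MemHs s δ φ → (∀ x, x ∉ U → φ x = 0) →
        |kernelForm k v φ| ≤ N * √(∫ x, φ x ^ 2)) →
      Integrable (fun x => (η (x + h) * (v (x + h + h) - v (x + h)) -
          η x * (v (x + h) - v x)) ^ 2) ∧
      ∫ x, (η (x + h) * (v (x + h + h) - v (x + h)) - η x * (v (x + h) - v x)) ^ 2 ≤
        C * (‖h‖ ^ (2 * s)) ^ 2 * N ^ 2 := by
  have hIn : 0 ≤ ∫ z : V n, ‖z‖ ^ 2 * nearKernel s δ z :=
    integral_nonneg fun z => mul_nonneg (sq_nonneg _) (nearKernel_nonneg _ _ _)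
  set I := ∫ z : V n, ‖z‖ ^ 2 * nearKernel s δ z with hI
  set C₁ := translateConst n s with hC₁
  have hC₁p : 0 < C₁ := translateConst_pos n s
  clear_value I C₁
  set B := √C₁ + Gam with hB
  have hB0 : 0 ≤ B := by positivity
  set C₄ := 2 / lam * (B ^ 2 / lam + lam * (2 * ℓ ^ 2 * I * C₁) / 4 + Lam * ℓ ^ 2 * I * C₁)
    with hC₄
  refine ⟨C₁ * C₄, by positivity, ?_⟩
  intro v η k U h N hN hv hvN hη hη1 hℓ hU h0 hδ hk hklow hkc hkh hφb
  have hr : 0 < ‖h‖ := norm_pos_iff.2 h0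
  set a := ‖h‖ ^ s with ha
  have ha0 : 0 < a := Real.rpow_pos_of_pos hr _
  have ha2 : ‖h‖ ^ (2 * s) = a ^ 2 := by
    rw [ha, ← Real.rpow_natCast, ← Real.rpow_mul hr.le]; congr 1; push_cast; ring
  rw [ha2]
  set w : V n → ℝ := fun x => v (x + h) - v x with hwdef
  have hw : MemHs s δ w := (hv.translate h).sub hv
  have hLw : ∫ x, w x ^ 2 ≤ C₁ * a ^ 2 * N ^ 2 := by
    have := integral_sq_translate_sub_le hs0 hv h0 hδ
    rw [ha2, ← hC₁] at this
    exact this.trans (mul_le_mul_of_nonneg_left hvN (by positivity))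
  obtain ⟨hηw, -⟩ := hw.cutoff_mul hn hs hη hη1 hℓ
  obtain ⟨hψ', hSψ⟩ := hηw.cutoff_mul hn hs hη hη1 hℓ
  set T := gagliardoSq s δ (fun x => η x * w x) with hT
  have hLηw : ∫ x, (η x * w x) ^ 2 ≤ ∫ x, w x ^ 2 := by
    refine integral_mono hηw.integrable_sq hw.integrable_sq fun x => ?_
    simp only [mul_pow]
    exact mul_le_of_le_one_left (sq_nonneg _) ((sq_le_one_iff_abs_le_one _).2 (hη1 x))
  set ψ : V n → ℝ := fun x => η x ^ 2 * w x with hψdef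
  have hψe : (fun x => η x * (η x * w x)) = ψ := by
    funext x; simp only [hψdef]; ring
  rw [hψe] at hψ' hSψ
  rw [← hI] at hSψ
  have hSψ2 : gagliardoSq s δ ψ ≤ 2 * T + 2 * ℓ ^ 2 * I * C₁ * a ^ 2 * N ^ 2 := by
    have := mul_le_mul_of_nonneg_left (hLηw.trans hLw) (by positivity : 0 ≤ ℓ ^ 2 * I)
    linarith
  have hcacc := mul_gagliardoSq_cutoff_le hn hs hη hℓ hw.measurable hw.integrable_sq hηw hk
    hklow hkc
  rw [← hI] at hcacc
  have hcacc2 : lam * T ≤ kernelForm k w ψ + Lam * ℓ ^ 2 * I * C₁ * a ^ 2 * N ^ 2 := by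
    have := mul_le_mul_of_nonneg_left hLw (by positivity : 0 ≤ Lam * ℓ ^ 2 * I)
    linarith
  have hE := kernelForm_translate_sub hv hψ' hk h hkc hkh
  have hE1 : |kernelForm k v (fun x => ψ (x + -h) - ψ x)| ≤
      N * √(C₁ * a ^ 2 * gagliardoSq s δ ψ) := by
    refine (hφb _ ((hψ'.translate (-h)).sub hψ') fun x hx => ?_).trans ?_
    · have h1 : η x = 0 := by
        by_contra hne; exact hx (hU x hne).1
      have h2 : η (x + -h) = 0 := by
        by_contra hne
        have := (hU _ hne).2
        rw [neg_add_cancel_right] at this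
        exact hx this
      simp [hψdef, h1, h2]
    · gcongr
      have := integral_sq_translate_sub_le hs0 hψ' (neg_ne_zero.2 h0) (by rwa [norm_neg])
      rwa [norm_neg, ha2, ← hC₁] at this
  have hE2 := abs_kernelForm_le (c := Gam * a) (by positivity) (hv.translate h) hψ'
    (k := fun p => k (p.1 + h, p.2 + h) - k p) (by fun_prop) hkh
  rw [gagliardoSq_translate] at hE2
  set X := √(gagliardoSq s δ ψ) with hX
  have hX0 : 0 ≤ X := Real.sqrt_nonneg _
  have hX2 : X ^ 2 = gagliardoSq s δ ψ := Real.sq_sqrt (gagliardoSq_nonneg _ _ _)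
  have hE1' : N * √(C₁ * a ^ 2 * gagliardoSq s δ ψ) = √C₁ * a * N * X := by
    rw [Real.sqrt_mul (by positivity), Real.sqrt_mul hC₁p.le, Real.sqrt_sq ha0.le]; ring
  have hE2' : Gam * a * √(gagliardoSq s δ v * gagliardoSq s δ ψ) ≤ Gam * a * N * X := by
    rw [Real.sqrt_mul (gagliardoSq_nonneg _ _ _)]
    have : √(gagliardoSq s δ v) ≤ N := Real.sqrt_le_iff.2 ⟨hN, hvN⟩
    calc _ ≤ Gam * a * (N * X) := by gcongr
      _ = _ := by ring
  have hEle : kernelForm k w ψ ≤ B * a * N * X := by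
    rw [hE]
    have := (abs_sub _ _).trans (add_le_add hE1 hE2)
    have := (le_abs_self _).trans this
    rw [hE1'] at this
    calc _ ≤ _ := this
      _ ≤ √C₁ * a * N * X + Gam * a * N * X := by linarith
      _ = _ := by rw [hB]; ring
  have hTle : T ≤ C₄ * a ^ 2 * N ^ 2 := by
    have h1 : B * a * N * X ≤ (B * a * N) ^ 2 / lam + lam * X ^ 2 / 4 := by
      have : 0 ≤ (B * a * N - lam * X / 2) ^ 2 / lam := by positivity
      have e : (B * a * N - lam * X / 2) ^ 2 / lam =
          (B * a * N) ^ 2 / lam + lam * X ^ 2 / 4 - B * a * N * X := by field_simp; ring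
      linarith
    rw [hX2] at h1
    have h2 : lam * T / 2 ≤
        (B ^ 2 / lam + lam * (2 * ℓ ^ 2 * I * C₁) / 4 + Lam * ℓ ^ 2 * I * C₁) * a ^ 2 * N ^ 2 := by
      have h3 := mul_le_mul_of_nonneg_left hSψ2 (by positivity : 0 ≤ lam / 4)
      have e : (B * a * N) ^ 2 / lam = B ^ 2 / lam * a ^ 2 * N ^ 2 := by ring
      rw [e] at h1
      nlinarith
    have h4 := mul_le_mul_of_nonneg_left h2 (by positivity : 0 ≤ 2 / lam)
    have e : 2 / lam * (lam * T / 2) = T := by field_simp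
    rw [e] at h4
    refine h4.trans (le_of_eq ?_)
    rw [hC₄]; ring
  have hfin := integral_sq_translate_sub_le hs0 hηw h0 hδ
  refine ⟨((hηw.translate h).sub hηw).integrable_sq, ?_⟩
  rw [ha2, ← hC₁] at hfin
  refine hfin.trans ?_
  calc C₁ * a ^ 2 * T ≤ C₁ * a ^ 2 * (C₄ * a ^ 2 * N ^ 2) := by gcongr
    _ = _ := by ring

/-- The part of the kernel at distance less than `δ` from the diagonal. -/
def nearPart (δ : ℝ) (K : V n → V n → ℝ) (p : V n × V n) : ℝ :=
  if ‖p.1 - p.2‖ < δ then K p.1 p.2 else 0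

/-- The part of the kernel at distance at least `δ` from the diagonal. -/
def farPart (δ : ℝ) (K : V n → V n → ℝ) (p : V n × V n) : ℝ :=
  if ‖p.1 - p.2‖ < δ then 0 else K p.1 p.2

lemma nearPart_add_farPart (δ : ℝ) (K : V n → V n → ℝ) (p : V n × V n) :
    nearPart δ K p + farPart δ K p = K p.1 p.2 := by
  unfold nearPart farPart
  split_ifs <;> simp

lemma measurableSet_near (δ : ℝ) : MeasurableSet {p : V n × V n | ‖p.1 - p.2‖ < δ} :=
  measurableSet_lt (by fun_prop) measurable_const

lemma measurable_nearPart (δ : ℝ) {K : V n → V n → ℝ} (hK : Measurable (Function.uncurry K)) :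
    Measurable (nearPart δ K) :=
  Measurable.ite (measurableSet_near δ) hK measurable_const

lemma measurable_farPart (δ : ℝ) {K : V n → V n → ℝ} (hK : Measurable (Function.uncurry K)) :
    Measurable (farPart δ K) :=
  Measurable.ite (measurableSet_near δ) measurable_const hK

lemma nearPart_bounds {s β lam Lam M δ : ℝ} (hs : 0 < s) (hlam : 0 < lam) (hδ : δ ≤ 1)
    {K : V n → V n → ℝ} (hK : KBounds s β lam Lam M K) :
    ∀ᵐ p : V n × V n, lam * nearKernel s δ (p.1 - p.2) ≤ nearPart δ K p ∧
      |nearPart δ K p| ≤ Lam * nearKernel s δ (p.1 - p.2) ∧ (‖p.1 - p.2‖ < δ → p.1 - p.2 ≠ 0) := by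
  filter_upwards [hK.1] with p hp
  by_cases h : ‖p.1 - p.2‖ < δ
  · obtain ⟨h1, h2⟩ := hp (h.trans_le hδ)
    have hq : ((n : ℝ) + 2 * s) ≠ 0 := by positivity
    have hne : p.1 - p.2 ≠ 0 := by
      intro h0
      rw [h0, norm_zero, Real.zero_rpow hq, zero_mul] at h1
      linarith
    have hz : 0 < ‖p.1 - p.2‖ := norm_pos_iff.2 hne
    have hzq : 0 < ‖p.1 - p.2‖ ^ ((n : ℝ) + 2 * s) := by positivity
    simp only [nearKernel, nearPart, if_pos h, Real.rpow_neg hz.le, ← div_eq_mul_inv]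
    have hlow : lam / ‖p.1 - p.2‖ ^ ((n : ℝ) + 2 * s) ≤ K p.1 p.2 := by
      rw [div_le_iff₀ hzq]; linarith
    have hK0 : 0 ≤ K p.1 p.2 := le_trans (by positivity) hlow
    refine ⟨hlow, ?_, fun _ => hne⟩
    rw [abs_of_nonneg hK0, le_div_iff₀ hzq]; linarith
  · simp [nearKernel, nearPart, h]

lemma nearPart_translate_bound {s β lam Lam M Gam δ : ℝ} (hs : 0 < s) (hlam : 0 < lam)
    (hδ : δ ≤ 1) {K : V n → V n → ℝ}
    (hK : KBounds s β lam Lam M K) (hH : KHolder s Gam K) :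
    ∀ᵐ h : V n, ‖h‖ < 1 → ∀ᵐ p : V n × V n,
      |nearPart δ K (p.1 + h, p.2 + h) - nearPart δ K p| ≤
        Gam * ‖h‖ ^ s * nearKernel s δ (p.1 - p.2) := by
  have hH' := Measure.ae_ae_of_ae_prod hH
  filter_upwards [hH'] with h hh h1
  filter_upwards [hh, nearPart_bounds hs hlam hδ hK] with p hp hb
  by_cases hn : ‖p.1 - p.2‖ < δ
  · have h2 := hp (hn.trans_le hδ) h1
    have hz : 0 < ‖p.1 - p.2‖ := norm_pos_iff.2 (hb.2.2 hn)
    have hzq : 0 < ‖p.1 - p.2‖ ^ ((n : ℝ) + 2 * s) := by positivity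
    simp only [nearKernel, nearPart, add_sub_add_right_eq_sub, if_pos hn, Real.rpow_neg hz.le,
      ← div_eq_mul_inv]
    rw [le_div_iff₀ hzq]; linarith
  · simp [nearKernel, nearPart, hn]

/-- The weight `(1 + |z|^{n+β})⁻¹`. -/
def tailWeight (β : ℝ) (z : V n) : ℝ := 1 / (1 + ‖z‖ ^ ((n : ℝ) + β))

lemma tailWeight_nonneg (β : ℝ) (z : V n) : 0 ≤ tailWeight β z := by
  unfold tailWeight; positivity

lemma tailWeight_neg (β : ℝ) (z : V n) : tailWeight β (-z) = tailWeight β z := by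
  simp [tailWeight]

@[fun_prop]
lemma measurable_tailWeight (β : ℝ) : Measurable (tailWeight (n := n) β) := by
  unfold tailWeight
  exact measurable_const.div (measurable_const.add (measurable_norm.pow_const _))

lemma add_rpow_le_two_rpow_mul {a b q : ℝ} (ha : 0 ≤ a) (hb : 0 ≤ b) (hq : 0 ≤ q) :
    (a + b) ^ q ≤ 2 ^ q * (a ^ q + b ^ q) := by
  have h1 : (a + b) ^ q ≤ (2 * max a b) ^ q :=
    Real.rpow_le_rpow (by positivity)
      (by linarith [le_max_left a b, le_max_right a b]) hq
  rw [Real.mul_rpow (by norm_num) (by positivity)] at h1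
  refine h1.trans (mul_le_mul_of_nonneg_left ?_ (by positivity))
  rcases le_total a b with h | h
  · rw [max_eq_right h]; linarith [Real.rpow_nonneg ha q]
  · rw [max_eq_left h]; linarith [Real.rpow_nonneg hb q]

lemma integrable_tailWeight {β : ℝ} (hβ : 0 < β) : Integrable (tailWeight (n := n) β) := by
  have h := (integrable_one_add_norm (E := V n) (μ := volume) (r := n + β)
    (by rw [finrank_V]; linarith)).const_mul (2 ^ ((n : ℝ) + β))
  refine h.mono' (by fun_prop) (ae_of_all _ fun z => ?_)
  rw [Real.norm_of_nonneg (tailWeight_nonneg _ _), tailWeight, Real.rpow_neg (by positivity),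
    ← div_eq_mul_inv, div_le_div_iff₀ (by positivity) (by positivity), one_mul]
  simpa using add_rpow_le_two_rpow_mul (zero_le_one) (norm_nonneg z)
    (by positivity : 0 ≤ (n : ℝ) + β)

lemma tailWeight_sub_le {β R : ℝ} (hβ : 0 < β) {x y : V n} (hx : ‖x‖ ≤ R) :
    tailWeight β (x - y) ≤
      (1 + 2 ^ ((n : ℝ) + β) * R ^ ((n : ℝ) + β) + 2 ^ ((n : ℝ) + β)) * tailWeight β y := by
  have hR : 0 ≤ R := (norm_nonneg x).trans hx
  have hq : 0 ≤ (n : ℝ) + β := by positivity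
  set q := (n : ℝ) + β
  have h1 : ‖y‖ ^ q ≤ 2 ^ q * (‖x - y‖ ^ q + R ^ q) := by
    refine le_trans (Real.rpow_le_rpow (norm_nonneg _) ?_ hq)
      (add_rpow_le_two_rpow_mul (norm_nonneg _) hR hq)
    have : y = x - (x - y) := by abel
    calc ‖y‖ = ‖x - (x - y)‖ := by rw [← this]
      _ ≤ ‖x‖ + ‖x - y‖ := norm_sub_le _ _
      _ ≤ _ := by linarith
  unfold tailWeight
  rw [mul_one_div, div_le_div_iff₀ (by positivity) (by positivity), one_mul]
  have h2 : 0 ≤ ‖x - y‖ ^ q := by positivity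
  have h3 : 0 ≤ (2 : ℝ) ^ q := by positivity
  have h4 : 0 ≤ R ^ q := by positivity
  nlinarith [mul_nonneg (mul_nonneg h3 h4) h2, mul_nonneg h3 h2]

lemma farPart_bound {s β lam Lam M δ : ℝ} (hs : 0 < s) (hβ : 0 < β) (hδ : 0 < δ)
    (hLam : 0 ≤ Lam) (hM : 0 ≤ M)
    {K : V n → V n → ℝ} (hK0 : ∀ x y, 0 ≤ K x y) (hK : KBounds s β lam Lam M K) :
    ∀ᵐ p : V n × V n, |farPart δ K p| ≤
      (2 * Lam * δ ^ (-((n : ℝ) + 2 * s)) + 2 * M) * tailWeight β (p.1 - p.2) := by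
  filter_upwards [hK.1, hK.2] with p h1 h2
  have hq : 0 ≤ (n : ℝ) + β := by positivity
  have hq2 : 0 ≤ (n : ℝ) + 2 * s := by positivity
  have hC : 0 ≤ 2 * Lam * δ ^ (-((n : ℝ) + 2 * s)) := by positivity
  unfold farPart
  split_ifs with h
  · simpa using mul_nonneg (by positivity) (tailWeight_nonneg β (p.1 - p.2))
  · push Not at h
    rw [abs_of_nonneg (hK0 _ _), tailWeight, mul_one_div, le_div_iff₀ (by positivity)]
    have hz : 0 < ‖p.1 - p.2‖ := hδ.trans_le h
    by_cases hlt : ‖p.1 - p.2‖ < 1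
    · have h3 := (h1 hlt).2
      have h4 : δ ^ ((n : ℝ) + 2 * s) ≤ ‖p.1 - p.2‖ ^ ((n : ℝ) + 2 * s) :=
        Real.rpow_le_rpow hδ.le h hq2
      have h5 : K p.1 p.2 ≤ Lam * δ ^ (-((n : ℝ) + 2 * s)) := by
        rw [Real.rpow_neg hδ.le, ← div_eq_mul_inv, le_div_iff₀ (by positivity)]
        nlinarith [mul_le_mul_of_nonneg_right h4 (hK0 p.1 p.2)]
      have h6 : ‖p.1 - p.2‖ ^ ((n : ℝ) + β) ≤ 1 := Real.rpow_le_one hz.le hlt.le hq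
      nlinarith [hK0 p.1 p.2]
    · push Not at hlt
      have h3 := (h2 hlt).2
      have h6 : 1 ≤ ‖p.1 - p.2‖ ^ ((n : ℝ) + β) := Real.one_le_rpow hlt hq
      nlinarith [hK0 p.1 p.2]

lemma integral_abs_mul_le {f g : V n → ℝ} (hf : Measurable f) (hg : Measurable g)
    (hf2 : Integrable (fun x => f x ^ 2)) (hg2 : Integrable (fun x => g x ^ 2)) :
    Integrable (fun x => |f x * g x|) ∧
      ∫ x, |f x * g x| ≤ √(∫ x, f x ^ 2) * √(∫ x, g x ^ 2) := by
  have hi : Integrable (fun x => |f x * g x|) := by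
    refine (hf2.add hg2).mono' (by fun_prop) (ae_of_all _ fun x => ?_)
    rw [Real.norm_eq_abs, abs_abs, abs_le]
    simp only [Pi.add_apply]
    constructor <;> nlinarith [sq_nonneg (f x + g x), sq_nonneg (f x - g x)]
  refine ⟨hi, ?_⟩
  rw [← Real.sqrt_mul (integral_nonneg fun _ => sq_nonneg _)]
  refine Real.le_sqrt_of_sq_le ?_
  have := sq_integral_mul_mul_le (μ := volume) (f := fun x => |f x|) (g := fun x => |g x|)
    (q := fun _ => 1) (fun _ => zero_le_one) (by simpa using hf2) (by simpa using hg2)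
    (by simpa [abs_mul] using hi)
  simpa [abs_mul] using this

/-- The long-range part of the form acts boundedly in `L²` on functions of bounded support. -/
lemma abs_kernelForm_far_le {β R c : ℝ} (hβ : 0 < β) (hR : 0 ≤ R) (hc : 0 ≤ c)
    {Ω : Set (V n)} (hΩ : MeasurableSet Ω) {u φ : V n → ℝ} (hu : Measurable u)
    (hu2 : IntegrableOn (fun x => u x ^ 2) Ω) (huw : HasFiniteWnorm β 0 u)
    (hφ : Measurable φ) (hφ2 : Integrable (fun x => φ x ^ 2))
    (hφΩ : ∀ x, φ x ≠ 0 → x ∈ Ω ∧ ‖x‖ ≤ R)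
    {k : V n × V n → ℝ} (hk : Measurable k)
    (hkc : ∀ᵐ p : V n × V n, |k p| ≤ c * tailWeight β (p.1 - p.2)) :
    Integrable (fun p : V n × V n => (u p.1 - u p.2) * (φ p.1 - φ p.2) * k p) ∧
      |kernelForm k u φ| ≤ 2 * c * ((∫ z : V n, tailWeight β z) * √(∫ x in Ω, u x ^ 2) +
        (1 + 2 ^ ((n : ℝ) + β) * R ^ ((n : ℝ) + β) + 2 ^ ((n : ℝ) + β)) *
          √(volume.real (closedBall (0 : V n) R)) * wnorm β 0 u) * √(∫ x, φ x ^ 2) := by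
  set CR := 1 + 2 ^ ((n : ℝ) + β) * R ^ ((n : ℝ) + β) + 2 ^ ((n : ℝ) + β) with hCR
  have hJ := integrable_tailWeight (n := n) hβ
  have hJ0 : 0 ≤ ∫ z : V n, tailWeight β z := integral_nonneg fun z => tailWeight_nonneg _ _
  -- the diagonal term
  have huΩ : Measurable (Ω.indicator u) := hu.indicator hΩ
  have hu2' : Integrable (fun x => Ω.indicator u x ^ 2) := by
    rw [← integrable_indicator_iff hΩ] at hu2
    refine hu2.congr (ae_of_all _ fun x => ?_)
    by_cases hx : x ∈ Ω <;> simp [hx]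
  have hu2I : ∫ x, Ω.indicator u x ^ 2 = ∫ x in Ω, u x ^ 2 := by
    rw [← integral_indicator hΩ]
    refine integral_congr_ae (ae_of_all _ fun x => ?_)
    by_cases hx : x ∈ Ω <;> simp [hx]
  obtain ⟨hA, hAle⟩ := integral_abs_mul_le huΩ hφ hu2' hφ2
  have hAe : (fun x => |Ω.indicator u x * φ x|) = fun x => |u x * φ x| := by
    funext x
    by_cases hx : φ x = 0
    · simp [hx]
    · simp [(hφΩ x hx).1]
  rw [hAe] at hA
  rw [hu2I, show ∫ x, |Ω.indicator u x * φ x| = ∫ x, |u x * φ x| from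
    congrArg (fun f => ∫ x, f x) hAe] at hAle
  -- the mass of the test function
  have hB1 : Integrable (fun x => (closedBall (0 : V n) R).indicator (fun _ => (1 : ℝ)) x ^ 2) := by
    have : Integrable ((closedBall (0 : V n) R).indicator (fun _ => (1 : ℝ))) := by
      rw [integrable_indicator_iff measurableSet_closedBall]
      exact integrableOn_const measure_closedBall_lt_top.ne
    refine this.congr (ae_of_all _ fun x => ?_)
    by_cases hx : x ∈ closedBall (0 : V n) R <;> simp only [indicator, hx] <;> simp
  have hB1I : ∫ x, (closedBall (0 : V n) R).indicator (fun _ => (1 : ℝ)) x ^ 2 =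
      volume.real (closedBall (0 : V n) R) := by
    have : ∫ x, (closedBall (0 : V n) R).indicator (fun _ => (1 : ℝ)) x =
      volume.real (closedBall (0 : V n) R) := by
      rw [integral_indicator measurableSet_closedBall]; simp
    rw [← this]
    refine integral_congr_ae (ae_of_all _ fun x => ?_)
    by_cases hx : x ∈ closedBall (0 : V n) R <;> simp only [indicator, hx] <;> simp
  obtain ⟨hB, hBle⟩ := integral_abs_mul_le
    (measurable_const.indicator measurableSet_closedBall) hφ hB1 hφ2
  have hBe : (fun x => |(closedBall (0 : V n) R).indicator (fun _ => (1 : ℝ)) x * φ x|) =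
      fun x => |φ x| := by
    funext x
    by_cases hx : φ x = 0
    · simp [hx]
    · have : x ∈ closedBall (0 : V n) R := by simpa using (hφΩ x hx).2
      simp only [indicator, this]; simp
  rw [hBe] at hB
  rw [hB1I, show ∫ x, |(closedBall (0 : V n) R).indicator (fun _ => (1 : ℝ)) x * φ x| =
    ∫ x, |φ x| from congrArg (fun f => ∫ x, f x) hBe] at hBle
  have huw' : Integrable (fun x => |u x| * tailWeight β x) := by
    refine huw.congr (ae_of_all _ fun x => ?_)
    simp [tailWeight, div_eq_mul_inv]
  have huwI : ∫ x, |u x| * tailWeight β x = wnorm β 0 u := by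
    unfold wnorm
    refine integral_congr_ae (ae_of_all _ fun x => ?_)
    simp [tailWeight, div_eq_mul_inv]
  have h1 := integrable_mul_sub_snd hA hJ (tailWeight_neg β)
  have e1 := integral_mul_sub_snd _ _ hA hJ (tailWeight_neg β)
  have h2 := hB.mul_prod huw'
  have e2 : ∫ p : V n × V n, |φ p.1| * (|u p.2| * tailWeight β p.2) =
      (∫ x, |φ x|) * wnorm β 0 u := by
    rw [← huwI]; exact integral_prod_mul (fun x => |φ x|) (fun y => |u y| * tailWeight β y)
  set Mj : V n × V n → ℝ := fun p => |u p.1 * φ p.1| * tailWeight β (p.1 - p.2) +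
    CR * (|φ p.1| * (|u p.2| * tailWeight β p.2)) with hMj
  have hMi : Integrable Mj := h1.add (h2.const_mul CR)
  have hMI : ∫ p, Mj p = (∫ x, |u x * φ x|) * (∫ z : V n, tailWeight β z) +
      CR * ((∫ x, |φ x|) * wnorm β 0 u) := by
    rw [hMj, integral_add h1 (h2.const_mul CR), e1, integral_const_mul, e2]
  have hMs := integrable_swap hMi
  have hpt : ∀ x y : V n, (|u x| + |u y|) * |φ x| * tailWeight β (x - y) ≤ Mj (x, y) := by
    intro x y
    simp only [hMj, abs_mul]
    by_cases hx : φ x = 0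
    · simp [hx]
    · have := tailWeight_sub_le hβ (y := y) (hφΩ x hx).2
      have := mul_le_mul_of_nonneg_left this (mul_nonneg (abs_nonneg (φ x)) (abs_nonneg (u y)))
      nlinarith
  have hle : ∀ᵐ p : V n × V n, ‖(u p.1 - u p.2) * (φ p.1 - φ p.2) * k p‖ ≤
      c * (Mj p + Mj (p.2, p.1)) := by
    filter_upwards [hkc] with p hp
    have ha := hpt p.1 p.2
    have hb := hpt p.2 p.1
    rw [show tailWeight β (p.2 - p.1) = tailWeight β (p.1 - p.2) by
      rw [← tailWeight_neg, neg_sub]] at hb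
    rw [Real.norm_eq_abs, abs_mul, abs_mul]
    have hJp := tailWeight_nonneg β (p.1 - p.2)
    calc _ ≤ (|u p.1| + |u p.2|) * (|φ p.1| + |φ p.2|) * (c * tailWeight β (p.1 - p.2)) := by
          gcongr
          · exact abs_sub _ _
          · exact abs_sub _ _
      _ = c * ((|u p.1| + |u p.2|) * |φ p.1| * tailWeight β (p.1 - p.2) +
          (|u p.2| + |u p.1|) * |φ p.2| * tailWeight β (p.1 - p.2)) := by ring
      _ ≤ _ := mul_le_mul_of_nonneg_left (add_le_add ha hb) hc
  have hmaj : Integrable (fun p : V n × V n => c * (Mj p + Mj (p.2, p.1))) :=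
    (hMi.add hMs).const_mul c
  refine ⟨hmaj.mono' (by fun_prop) hle, ?_⟩
  have h3 := norm_integral_le_of_norm_le hmaj hle
  rw [integral_const_mul, integral_add hMi hMs, integral_swap, hMI, Real.norm_eq_abs] at h3
  refine h3.trans ?_
  have hW : 0 ≤ wnorm β 0 u := by
    rw [← huwI]
    exact integral_nonneg fun x => mul_nonneg (abs_nonneg _) (tailWeight_nonneg _ _)
  have hCR0 : 0 ≤ CR := by positivity
  have h4 := mul_le_mul_of_nonneg_right hAle hJ0
  have h5 := mul_le_mul_of_nonneg_left (mul_le_mul_of_nonneg_right hBle hW) hCR0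
  have := mul_le_mul_of_nonneg_left (add_le_add h4 h5) hc
  linarith

lemma measurableSet_crossSet {Ω : Set (V n)} (hΩ : MeasurableSet Ω) :
    MeasurableSet (crossSet Ω) :=
  (measurable_fst hΩ).union (measurable_snd hΩ)

lemma L2norm_eq_sqrt (A : Set (V n)) (u : V n → ℝ) : L2norm A u = √(∫ x in A, u x ^ 2) := by
  rw [L2norm, Real.sqrt_eq_rpow]

lemma MemHs.memX {s β lam Lam M δ : ℝ} (hs : 0 < s) (hβ : 0 < β) (hlam : 0 < lam)
    (hlL : lam ≤ Lam) (hM : 0 < M) (hδ0 : 0 < δ) (hδ : δ ≤ 1) (Ω : Set (V n))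
    {K : V n → V n → ℝ} (hKm : Measurable (Function.uncurry K)) (hK0 : ∀ x y, 0 ≤ K x y)
    (hK : KBounds s β lam Lam M K) {φ : V n → ℝ} (hφ : MemHs s δ φ) : MemX Ω K φ := by
  have hm := hφ.measurable
  refine ⟨hφ.measurable, hφ.integrable_sq.integrableOn, Integrable.integrableOn ?_⟩
  have hJ := integrable_tailWeight (n := n) hβ
  have hLam : 0 < Lam := hlam.trans_le hlL
  set c := 2 * Lam * δ ^ (-((n : ℝ) + 2 * s)) + 2 * M with hc
  have hc0 : 0 ≤ c := by positivity
  have h1 := integrable_mul_sub_snd hφ.integrable_sq hJ (tailWeight_neg β)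
  have h2 := integrable_mul_sub_fst hφ.integrable_sq hJ
  have hKm' : Measurable (fun p : V n × V n => K p.1 p.2) := hKm
  refine ((hφ.integrable_gagliardo.const_mul Lam).add ((h1.add h2).const_mul (2 * c))).mono'
    (by fun_prop) ?_
  filter_upwards [nearPart_bounds hs hlam hδ hK, farPart_bound hs hβ hδ0 hLam.le hM.le hK0 hK]
    with p hp hp'
  rw [Real.norm_of_nonneg (mul_nonneg (sq_nonneg _) (hK0 _ _)), ← nearPart_add_farPart δ K]
  have ha := mul_le_mul_of_nonneg_left ((le_abs_self _).trans hp.2.1) (sq_nonneg (φ p.1 - φ p.2))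
  have hb := (le_abs_self _).trans hp'
  have hJp : 0 ≤ c * tailWeight β (p.1 - p.2) := mul_nonneg hc0 (tailWeight_nonneg _ _)
  have hb1 := mul_le_mul_of_nonneg_left hb (sq_nonneg (φ p.1 - φ p.2))
  have hb2 : (φ p.1 - φ p.2) ^ 2 ≤ 2 * (φ p.1 ^ 2 + φ p.2 ^ 2) := by
    nlinarith [sq_nonneg (φ p.1 + φ p.2)]
  have hb3 := mul_le_mul_of_nonneg_right hb2 hJp
  simp only [Pi.add_apply]
  linarith

/-- The short-range part of the form of a weak solution acts boundedly in `L²` on test functions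
of bounded support. -/
lemma exists_abs_kernelForm_near_le {s β lam Lam M δ R : ℝ} (hs : 0 < s) (hβ : 0 < β)
    (hlam : 0 < lam) (hlL : lam ≤ Lam) (hM : 0 < M) (hδ0 : 0 < δ) (hδ : δ ≤ 1) (hR : 0 ≤ R)
    {Ω : Set (V n)} (hΩ : MeasurableSet Ω) :
    ∃ C, 1 ≤ C ∧ ∀ (K : V n → V n → ℝ) (u f : V n → ℝ),
      Measurable (Function.uncurry K) → (∀ x y, 0 ≤ K x y) →
      KBounds s β lam Lam M K → MemX Ω K u → HasFiniteWnorm β 0 u →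
      Measurable f → IntegrableOn (fun x => f x ^ 2) Ω → IsSolution Ω K u f →
      ∀ φ : V n → ℝ, MemHs s δ φ → (∀ x, φ x ≠ 0 → x ∈ Ω ∧ ‖x‖ ≤ R) →
        |kernelForm (nearPart δ K) u φ| ≤
          C * (L2norm Ω u + wnorm β 0 u + L2norm Ω f) * √(∫ x, φ x ^ 2) := by
  have hLam : 0 < Lam := hlam.trans_le hlL
  set c := 2 * Lam * δ ^ (-((n : ℝ) + 2 * s)) + 2 * M with hc
  have hc0 : 0 ≤ c := by positivity
  set J := ∫ z : V n, tailWeight β z with hJ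
  have hJ0 : 0 ≤ J := integral_nonneg fun z => tailWeight_nonneg _ _
  set D := (1 + 2 ^ ((n : ℝ) + β) * R ^ ((n : ℝ) + β) + 2 ^ ((n : ℝ) + β)) *
          √(volume.real (closedBall (0 : V n) R)) with hD
  have hD0 : 0 ≤ D := by positivity
  refine ⟨1 + 2 * c * J + 2 * c * D, by nlinarith [mul_nonneg hc0 hJ0, mul_nonneg hc0 hD0], ?_⟩
  intro K u f hKm hK0 hK hu huw hf hf2 hsol φ hφ hφΩ
  have hX := hφ.memX hs hβ hlam hlL hM hδ0 hδ Ω hKm hK0 hK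
  have hz : ∀ x, x ∉ Ω → φ x = 0 := fun x hx => by
    by_contra hne; exact hx (hφΩ x hne).1
  have hE := hsol φ ⟨hX, ae_of_all _ hz⟩
  have hum := hu.1
  have hφm := hφ.measurable
  have hKm' : Measurable (fun p : V n × V n => K p.1 p.2) := hKm
  have hfull : Integrable (fun p : V n × V n => (u p.1 - u p.2) * (φ p.1 - φ p.2) * K p.1 p.2) := by
    have hcr := measurableSet_crossSet hΩ
    have h1 : IntegrableOn
        (fun p : V n × V n => (u p.1 - u p.2) * (φ p.1 - φ p.2) * K p.1 p.2) (crossSet Ω) := by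
      refine (hu.2.2.add hX.2.2).mono' (Measurable.aestronglyMeasurable (by fun_prop))
        (ae_of_all _ fun p => ?_)
      rw [Real.norm_eq_abs, abs_mul, abs_of_nonneg (hK0 _ _)]
      simp only [Pi.add_apply]
      rw [← add_mul]
      refine mul_le_mul_of_nonneg_right ?_ (hK0 _ _)
      rw [abs_le]; constructor <;>
      nlinarith [sq_nonneg (u p.1 - u p.2 + (φ p.1 - φ p.2)),
        sq_nonneg (u p.1 - u p.2 - (φ p.1 - φ p.2)), sq_nonneg (u p.1 - u p.2),
        sq_nonneg (φ p.1 - φ p.2)]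
    refine (integrableOn_iff_integrable_of_support_subset fun p hp => ?_).1 h1
    by_contra hne
    simp only [crossSet, Set.mem_ofPred_eq, not_or] at hne
    apply hp
    simp [hz _ hne.1, hz _ hne.2]
  obtain ⟨hfar, hfarle⟩ := abs_kernelForm_far_le hβ hR hc0 hΩ hum hu.2.1 huw hφm
    hφ.integrable_sq hφΩ (measurable_farPart δ hKm)
    (farPart_bound hs hβ hδ0 hLam.le hM.le hK0 hK)
  have e1 : energyForm K u φ =
      ∫ p : V n × V n, (u p.1 - u p.2) * (φ p.1 - φ p.2) * K p.1 p.2 :=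
    (integral_prod _ hfull).symm
  have e2 : kernelForm (nearPart δ K) u φ =
      (∫ x in Ω, f x * φ x) - kernelForm (farPart δ K) u φ := by
    rw [← hE, e1]
    unfold kernelForm
    rw [← integral_sub hfull hfar]
    refine integral_congr_ae (ae_of_all _ fun p => ?_)
    simp only [← nearPart_add_farPart δ K p]
    ring
  have hfφ : |∫ x in Ω, f x * φ x| ≤ L2norm Ω f * √(∫ x, φ x ^ 2) := by
    have hf2' : Integrable (fun x => Ω.indicator f x ^ 2) := by
      rw [← integrable_indicator_iff hΩ] at hf2
      refine hf2.congr (ae_of_all _ fun x => ?_)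
      by_cases hx : x ∈ Ω <;> simp [hx]
    have hf2I : ∫ x, Ω.indicator f x ^ 2 = ∫ x in Ω, f x ^ 2 := by
      rw [← integral_indicator hΩ]
      refine integral_congr_ae (ae_of_all _ fun x => ?_)
      by_cases hx : x ∈ Ω <;> simp [hx]
    have := (integral_abs_mul_le (hf.indicator hΩ) hφm hf2' hφ.integrable_sq).2
    rw [hf2I, ← L2norm_eq_sqrt] at this
    refine le_trans ?_ this
    rw [← integral_indicator hΩ]
    refine le_trans (le_of_eq ?_) (abs_integral_le_integral_abs)
    congr 1
    refine integral_congr_ae (ae_of_all _ fun x => ?_)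
    by_cases hx : x ∈ Ω <;> simp [hx]
  rw [← hJ, ← hD, ← L2norm_eq_sqrt] at hfarle
  have hnu : 0 ≤ L2norm Ω u := by rw [L2norm_eq_sqrt]; positivity
  have hnf : 0 ≤ L2norm Ω f := by rw [L2norm_eq_sqrt]; positivity
  have hnw : 0 ≤ wnorm β 0 u := integral_nonneg fun x => by positivity
  rw [e2]
  have hφn : 0 ≤ √(∫ x, φ x ^ 2) := Real.sqrt_nonneg _
  refine ((abs_sub _ _).trans (add_le_add hfφ hfarle)).trans ?_
  rw [← add_mul]
  refine mul_le_mul_of_nonneg_right ?_ hφn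
  have := mul_nonneg hc0 hJ0
  have := mul_nonneg hc0 hD0
  nlinarith [mul_nonneg (mul_nonneg hc0 hJ0) hnw, mul_nonneg (mul_nonneg hc0 hJ0) hnf,
    mul_nonneg (mul_nonneg hc0 hD0) hnu, mul_nonneg (mul_nonneg hc0 hD0) hnf]

/-- A Lipschitz cutoff, equal to one on `E` and supported in its `δ`-thickening. -/
lemma exists_lipschitz_cutoff (E : Set (V n)) {δ : ℝ} (hδ : 0 < δ) :
    ∃ η : V n → ℝ, Measurable η ∧ (∀ x, |η x| ≤ 1) ∧
      (∀ x y, (η x - η y) ^ 2 ≤ (1 / δ) ^ 2 * ‖x - y‖ ^ 2) ∧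
      (∀ x ∈ E, η x = 1) ∧ ∀ x, η x ≠ 0 → x ∈ thickening δ E := by
  refine ⟨fun x => (thickenedIndicator hδ E x : ℝ), ?_, fun x => ?_, fun x y => ?_,
    fun x hx => ?_, fun x hx => ?_⟩
  · exact (NNReal.continuous_coe.comp (thickenedIndicator hδ E).continuous).measurable
  · rw [abs_of_nonneg (NNReal.coe_nonneg _)]
    exact_mod_cast thickenedIndicator_le_one hδ E x
  · have h := (lipschitzWith_thickenedIndicator hδ E).dist_le_mul x y
    rw [NNReal.dist_eq, dist_eq_norm, NNReal.coe_inv, Real.coe_toNNReal _ hδ.le] at h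
    rw [← sq_abs, ← mul_pow, one_div]
    exact pow_le_pow_left₀ (abs_nonneg _) h 2
  · simp [thickenedIndicator_one hδ E hx]
  · by_contra hne
    exact hx (by simp [thickenedIndicator_zero hδ E hne])

lemma kernelForm_nearPart_congr {δ : ℝ} (hδ : 0 < δ) {S : Set (V n)} {u w φ : V n → ℝ}
    (K : V n → V n → ℝ) (hφ : ∀ x, φ x ≠ 0 → x ∈ S)
    (huw : ∀ x ∈ S, ∀ y, ‖x - y‖ < δ → u y = w y) :
    kernelForm (nearPart δ K) u φ = kernelForm (nearPart δ K) w φ := by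
  refine integral_congr_ae (ae_of_all _ fun p => ?_)
  by_cases hp : ‖p.1 - p.2‖ < δ
  · have hp' : ‖p.2 - p.1‖ < δ := by rwa [norm_sub_rev]
    have h0 : ∀ x : V n, ‖x - x‖ < δ := fun x => by simpa using hδ
    by_cases h1 : φ p.1 = 0
    · by_cases h2 : φ p.2 = 0
      · simp [h1, h2]
      · simp only [huw _ (hφ _ h2) _ hp', huw _ (hφ _ h2) _ (h0 _)]
    · simp only [huw _ (hφ _ h1) _ hp, huw _ (hφ _ h1) _ (h0 _)]
  · simp [nearPart, hp]

lemma integrable_sq_indicator {A : Set (V n)} (hA : MeasurableSet A) {u : V n → ℝ}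
    (hu : IntegrableOn (fun x => u x ^ 2) A) :
    Integrable (fun x => A.indicator u x ^ 2) ∧
      ∫ x, A.indicator u x ^ 2 = ∫ x in A, u x ^ 2 := by
  have h : (fun x => A.indicator u x ^ 2) = A.indicator (fun x => u x ^ 2) := by
    funext x
    by_cases hx : x ∈ A <;> simp [hx]
  rw [h, integral_indicator hA]
  exact ⟨(integrable_indicator_iff hA).2 hu, rfl⟩

/-- Localizing a function of finite energy by a Lipschitz cutoff. -/
lemma MemX.memHs_cutoff_mul (hn : 1 ≤ n) {s β lam Lam M δ ℓ : ℝ} (hs0 : 0 < s) (hs : s < 1)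
    (hlam : 0 < lam) (hδ0 : 0 < δ) (hδ : δ ≤ 1) {Ω E : Set (V n)} (hΩ : MeasurableSet Ω)
    (hE : MeasurableSet E) (hEΩ : E ⊆ Ω) {K : V n → V n → ℝ} (hK0 : ∀ x y, 0 ≤ K x y)
    (hK : KBounds s β lam Lam M K) {u : V n → ℝ} (hu : MemX Ω K u) {ζ : V n → ℝ}
    (hζ : Measurable ζ) (hζ1 : ∀ x, |ζ x| ≤ 1)
    (hζℓ : ∀ x y, (ζ x - ζ y) ^ 2 ≤ ℓ ^ 2 * ‖x - y‖ ^ 2)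
    (hζE : ∀ x, ζ x ≠ 0 → ∀ y, ‖x - y‖ < δ → y ∈ E) :
    MemHs s δ (fun x => ζ x * E.indicator u x) := by
  have hG : Integrable ((crossSet Ω).indicator
      (fun p : V n × V n => 1 / lam * ((u p.1 - u p.2) ^ 2 * K p.1 p.2))) :=
    (integrable_indicator_iff (measurableSet_crossSet hΩ)).2 (hu.2.2.const_mul _)
  refine (memHs_mul hn hs hζ hζ1 hζℓ (hu.1.indicator hE)
    (integrable_sq_indicator hE (hu.2.1.mono_set hEΩ)).1 hG ?_).1
  filter_upwards [nearPart_bounds hs0 hlam hδ hK] with p hp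
  have h0 : 0 ≤ (crossSet Ω).indicator
      (fun p : V n × V n => 1 / lam * ((u p.1 - u p.2) ^ 2 * K p.1 p.2)) p := by
    refine indicator_nonneg (fun q _ => ?_) p
    have := hK0 q.1 q.2
    positivity
  by_cases hp1 : ζ p.1 = 0
  · simpa [hp1] using h0
  by_cases hpn : ‖p.1 - p.2‖ < δ
  · have hx : p.1 ∈ E := hζE _ hp1 _ (by simpa using hδ0)
    have hy : p.2 ∈ E := hζE _ hp1 _ hpn
    have hc : p ∈ crossSet Ω := Or.inl (hEΩ hx)
    rw [indicator_of_mem hc, indicator_of_mem hx, indicator_of_mem hy]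
    have hk := nearKernel_nonneg s δ (p.1 - p.2)
    have hb : lam * nearKernel s δ (p.1 - p.2) ≤ K p.1 p.2 := by
      have := hp.1
      rwa [nearPart, if_pos hpn] at this
    have hζ2 := (sq_le_one_iff_abs_le_one _).2 (hζ1 p.1)
    rw [one_div_mul_eq_div, le_div_iff₀ hlam]
    calc _ = ζ p.1 ^ 2 * ((u p.1 - u p.2) ^ 2 * (lam * nearKernel s δ (p.1 - p.2))) := by ring
      _ ≤ 1 * ((u p.1 - u p.2) ^ 2 * K p.1 p.2) := by gcongr
      _ = _ := one_mul _
  · rw [nearKernel_of_le (not_lt.1 hpn), mul_zero]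
    exact h0

/-- A Caccioppoli inequality. -/
lemma exists_gagliardoSq_cutoff_le (hn : 1 ≤ n) {s β lam Lam M δ : ℝ} (hs0 : 0 < s) (hs : s < 1)
    (hlam : 0 < lam) (hlL : lam ≤ Lam) (hδ0 : 0 < δ) (hδ : δ ≤ 1) {B : ℝ} (hB : 0 ≤ B) (ℓ : ℝ)
    {Ω E : Set (V n)} (hΩ : MeasurableSet Ω) (hE : MeasurableSet E) (hEΩ : E ⊆ Ω) {ζ : V n → ℝ}
    (hζ : Measurable ζ) (hζ1 : ∀ x, |ζ x| ≤ 1)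
    (hζℓ : ∀ x y, (ζ x - ζ y) ^ 2 ≤ ℓ ^ 2 * ‖x - y‖ ^ 2)
    (hζE : ∀ x, ζ x ≠ 0 → ∀ y, ‖x - y‖ < δ → y ∈ E) :
    ∃ C, 0 ≤ C ∧ ∀ (K : V n → V n → ℝ) (u : V n → ℝ) (N : ℝ),
      Measurable (Function.uncurry K) → (∀ x y, 0 ≤ K x y) →
      KBounds s β lam Lam M K → MemX Ω K u → L2norm Ω u ≤ N →
      (∀ φ : V n → ℝ, MemHs s δ φ → (∀ x, φ x ≠ 0 → x ∈ E) →
        |kernelForm (nearPart δ K) u φ| ≤ B * N * √(∫ x, φ x ^ 2)) →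
      gagliardoSq s δ (fun x => ζ x * E.indicator u x) ≤ C * N ^ 2 := by
  have hLam : 0 < Lam := hlam.trans_le hlL
  have hI0 : 0 ≤ ∫ z : V n, ‖z‖ ^ 2 * nearKernel s δ z :=
    integral_nonneg fun z => mul_nonneg (sq_nonneg _) (nearKernel_nonneg _ _ _)
  set I := ∫ z : V n, ‖z‖ ^ 2 * nearKernel s δ z with hI
  refine ⟨1 / lam * (B + Lam * (ℓ ^ 2 * I)), by positivity, ?_⟩
  intro K u N hKm hK0 hK hu huN hsol
  set w := E.indicator u with hw
  obtain ⟨hw2, hwI⟩ := integrable_sq_indicator hE (hu.2.1.mono_set hEΩ)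
  have hwm : Measurable w := hu.1.indicator hE
  have hN : 0 ≤ N := by
    refine le_trans ?_ huN
    rw [L2norm_eq_sqrt]
    positivity
  have hwN : ∫ x, w x ^ 2 ≤ N ^ 2 := by
    rw [L2norm_eq_sqrt] at huN
    rw [hwI]
    refine (setIntegral_mono_set hu.2.1 (ae_of_all _ fun x => sq_nonneg _)
      hEΩ.eventuallyLE).trans ?_
    exact (Real.sqrt_le_left hN).1 huN
  have hv := hu.memHs_cutoff_mul hn hs0 hs hlam hδ0 hδ hΩ hE hEΩ hK0 hK hζ hζ1 hζℓ hζE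
  have hφ : MemHs s δ (fun x => ζ x ^ 2 * w x) := by
    have := (hv.cutoff_mul hn hs hζ hζ1 hζℓ).1
    simpa [← mul_assoc, ← pow_two] using this
  have hbd := nearPart_bounds hs0 hlam hδ hK
  have hmain := mul_gagliardoSq_cutoff_le hn hs hζ hζℓ hwm hw2 hv (measurable_nearPart δ hKm)
    (hbd.mono fun p hp => hp.1) (hbd.mono fun p hp => hp.2.1)
  have hsupp : ∀ x, ζ x ^ 2 * w x ≠ 0 → x ∈ {x | ζ x ≠ 0} := fun x hx h0 => by
    simp [h0] at hx
  rw [← kernelForm_nearPart_congr hδ0 K hsupp (u := u) fun x hx y hxy => by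
    rw [hw, indicator_of_mem (hζE x hx y hxy)]] at hmain
  have h1 := (le_abs_self _).trans (hsol _ hφ fun x hx =>
    hζE x (hsupp x hx) x (by simpa using hδ0))
  have h2 : √(∫ x, (ζ x ^ 2 * w x) ^ 2) ≤ N := by
    refine (Real.sqrt_le_left hN).2 (le_trans ?_ hwN)
    refine integral_mono hφ.integrable_sq hw2 fun x => ?_
    have hζ2 := (sq_le_one_iff_abs_le_one _).2 (hζ1 x)
    have hζ4 : (ζ x ^ 2) ^ 2 ≤ 1 := pow_le_one₀ (sq_nonneg _) hζ2
    rw [mul_pow]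
    exact mul_le_of_le_one_left (sq_nonneg _) hζ4
  have h3 := mul_le_mul_of_nonneg_left h2 (mul_nonneg hB hN)
  have h4 := mul_le_mul_of_nonneg_left hwN (mul_nonneg hLam.le (mul_nonneg (sq_nonneg ℓ) hI0))
  rw [one_div, mul_assoc, inv_mul_eq_div, le_div_iff₀ hlam]
  nlinarith

lemma measurableSet_shift2 {U : Set (V n)} (hU : MeasurableSet U) (z : V n) :
    MeasurableSet (shift2 U z) :=
  hU.inter (((measurable_add_const z) hU).inter ((measurable_add_const (2 • z)) hU))

lemma exists_L2norm_diff2_le_of_small (hn : 1 ≤ n) {s β lam Lam M Gam : ℝ} (hs0 : 0 < s)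
    (hs : s < 1) (hβ : 0 < β) (hlam : 0 < lam) (hlL : lam ≤ Lam) (hM : 0 < M) (hGam : 0 < Gam)
    {Ω : Set (V n)} (hΩ : IsOpen Ω) {Ω' : Set (V n)} (hΩ' : IsOpen Ω')
    (hΩ'c : IsCompact (closure Ω')) (hΩ'Ω : closure Ω' ⊆ Ω) :
    ∃ δ > 0, ∃ C, 0 ≤ C ∧ ∀ (K : V n → V n → ℝ) (u f : V n → ℝ),
      Measurable (Function.uncurry K) → (∀ x y, 0 ≤ K x y) →
      KBounds s β lam Lam M K → KHolder s Gam K → MemX Ω K u → HasFiniteWnorm β 0 u →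
      Measurable f → IntegrableOn (fun x => f x ^ 2) Ω → IsSolution Ω K u f →
      ∀ᵐ h : V n, h ≠ 0 → ‖h‖ ≤ δ → L2norm (shift2 Ω' h) (diff2 h u) ^ 2 ≤
        C * (‖h‖ ^ (2 * s)) ^ 2 * (L2norm Ω u + wnorm β 0 u + L2norm Ω f) ^ 2 := by
  have hLam : 0 < Lam := hlam.trans_le hlL
  obtain ⟨r, hr0, hr⟩ := hΩ'c.exists_cthickening_subset_open hΩ hΩ'Ω
  obtain ⟨δ, hδ0, hδ1, hδr⟩ : ∃ δ : ℝ, 0 < δ ∧ δ ≤ 1 ∧ 5 * δ ≤ r :=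
    ⟨min (r / 5) 1, by positivity, min_le_right _ _, by linarith [min_le_left (r / 5) 1]⟩
  have hstep : ∀ (k : ℝ) (x y : V n), x ∈ thickening (k * δ) Ω' → ‖x - y‖ < δ →
      y ∈ thickening ((k + 1) * δ) Ω' := by
    intro k x y hx hxy
    rw [mem_thickening_iff] at hx ⊢
    obtain ⟨z, hz, hxz⟩ := hx
    refine ⟨z, hz, ?_⟩
    have := dist_triangle y x z
    rw [← dist_eq_norm, dist_comm] at hxy
    linarith
  set E : Set (V n) := thickening (5 * δ) Ω' with hE
  have hEΩ : E ⊆ Ω := (thickening_mono hδr _).trans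
    ((thickening_subset_cthickening _ _).trans ((cthickening_subset_of_subset _
      subset_closure).trans hr))
  have hEm : MeasurableSet E := isOpen_thickening.measurableSet
  have hEb : Bornology.IsBounded E := (hΩ'c.isBounded.subset subset_closure).thickening
  obtain ⟨R, hR0, hR⟩ : ∃ R : ℝ, 0 ≤ R ∧ ∀ x ∈ E, ‖x‖ ≤ R := by
    obtain ⟨R, hR⟩ := hEb.exists_norm_le
    exact ⟨max R 0, le_max_right _ _, fun x hx => (hR x hx).trans (le_max_left _ _)⟩
  obtain ⟨η, hη, hη1, hηℓ, hηE, hηs⟩ := exists_lipschitz_cutoff Ω' hδ0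
  obtain ⟨ζ, hζ, hζ1, hζℓ, hζE, hζs⟩ := exists_lipschitz_cutoff (thickening (3 * δ) Ω') hδ0
  have hζs' : ∀ x, ζ x ≠ 0 → ∀ y, ‖x - y‖ < δ → y ∈ E := by
    intro x hx y hxy
    have h := thickening_thickening_subset _ _ _ (hζs x hx)
    rw [show δ + 3 * δ = 4 * δ by ring] at h
    have := hstep 4 x y h hxy
    rwa [show ((4 : ℝ) + 1) * δ = 5 * δ by ring] at this
  obtain ⟨B, hB1, hB⟩ := exists_abs_kernelForm_near_le hs0 hβ hlam hlL hM hδ0 hδ1 hR0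
    hΩ.measurableSet
  have hB0 : 0 ≤ B := zero_le_one.trans hB1
  obtain ⟨C₁, hC₁, hcac⟩ := exists_gagliardoSq_cutoff_le (M := M) (β := β) hn hs0 hs hlam hlL hδ0
    hδ1 hB0 (1 / δ) hΩ.measurableSet hEm hEΩ hζ hζ1 hζℓ hζs'
  obtain ⟨C₂, hC₂, hdiff⟩ := exists_second_difference_bound hn hs0 hs hlam hLam.le hGam.le δ (1 / δ)
  refine ⟨δ / 2, by positivity, C₂ * (B + √C₁) ^ 2, by positivity, ?_⟩
  intro K u f hKm hK0 hK hKH hu huw hf hf2 hsol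
  set N := L2norm Ω u + wnorm β 0 u + L2norm Ω f with hN
  have hnu : 0 ≤ L2norm Ω u := by rw [L2norm_eq_sqrt]; positivity
  have hnf : 0 ≤ L2norm Ω f := by rw [L2norm_eq_sqrt]; positivity
  have hnw : 0 ≤ wnorm β 0 u := integral_nonneg fun x => by positivity
  have hN0 : 0 ≤ N := by positivity
  have hform : ∀ φ : V n → ℝ, MemHs s δ φ → (∀ x, φ x ≠ 0 → x ∈ E) →
      |kernelForm (nearPart δ K) u φ| ≤ B * N * √(∫ x, φ x ^ 2) := fun φ hφ hφE =>
    hB K u f hKm hK0 hK hu huw hf hf2 hsol φ hφ fun x hx =>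
      ⟨hEΩ (hφE x hx), hR x (hφE x hx)⟩
  set v : V n → ℝ := fun x => ζ x * E.indicator u x with hv
  have hvm : MemHs s δ v := hu.memHs_cutoff_mul hn hs0 hs hlam hδ0 hδ1 hΩ.measurableSet hEm hEΩ
    hK0 hK hζ hζ1 hζℓ hζs'
  have hgag := hcac K u N hKm hK0 hK hu (by linarith) hform
  have hvu : ∀ x ∈ thickening (3 * δ) Ω', v x = u x := by
    intro x hx
    have hxE : x ∈ E := thickening_mono (by linarith) _ hx
    rw [hv]
    simp only [hζE x hx, one_mul, indicator_of_mem hxE]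
  have hvN : gagliardoSq s δ v ≤ ((B + √C₁) * N) ^ 2 := by
    refine hgag.trans ?_
    rw [mul_pow]
    refine mul_le_mul_of_nonneg_right ?_ (sq_nonneg _)
    nlinarith [Real.sq_sqrt hC₁, Real.sqrt_nonneg C₁, mul_nonneg hB0 (Real.sqrt_nonneg C₁)]
  have hvform : ∀ φ : V n → ℝ, MemHs s δ φ → (∀ x, x ∉ thickening (2 * δ) Ω' → φ x = 0) →
      |kernelForm (nearPart δ K) v φ| ≤ (B + √C₁) * N * √(∫ x, φ x ^ 2) := by
    intro φ hφ hφ0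
    have hφ0' : ∀ x, φ x ≠ 0 → x ∈ thickening (2 * δ) Ω' := fun x hx => by
      by_contra hne
      exact hx (hφ0 x hne)
    rw [← kernelForm_nearPart_congr hδ0 K hφ0' (u := u) fun x hx y hxy => by
      have := hstep 2 x y hx hxy
      rw [show ((2 : ℝ) + 1) * δ = 3 * δ by ring] at this
      exact (hvu y this).symm]
    refine (hform φ hφ fun x hx => thickening_mono (by linarith) _ (hφ0' x hx)).trans ?_
    gcongr
    exact le_add_of_nonneg_right (Real.sqrt_nonneg _)
  have hbd := nearPart_bounds hs0 hlam hδ1 hK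
  filter_upwards [nearPart_translate_bound hs0 hlam hδ1 hK hKH] with h hkh h0 hhδ
  obtain ⟨hi, hle⟩ := hdiff v η (nearPart δ K) (thickening (2 * δ) Ω') h ((B + √C₁) * N)
    (by positivity) hvm hvN hη hη1 hηℓ (fun x hx => by
      have h1 : x ∈ thickening (1 * δ) Ω' := by simpa using hηs x hx
      refine ⟨thickening_mono (by linarith) _ h1, ?_⟩
      have := hstep 1 x (x + h) h1 (by simp; linarith)
      rwa [show ((1 : ℝ) + 1) * δ = 2 * δ by ring] at this)
    h0 (by linarith) (measurable_nearPart δ hKm) (hbd.mono fun p hp => hp.1)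
    (hbd.mono fun p hp => hp.2.1) (hkh (by linarith)) hvform
  have hsub : Ω' ⊆ thickening (3 * δ) Ω' := self_subset_thickening (by positivity) _
  rw [L2norm_eq_sqrt, Real.sq_sqrt (integral_nonneg fun _ => sq_nonneg _)]
  calc ∫ x in shift2 Ω' h, diff2 h u x ^ 2
      = ∫ x in shift2 Ω' h, (η (x + h) * (v (x + h + h) - v (x + h)) -
          η x * (v (x + h) - v x)) ^ 2 := by
        refine setIntegral_congr_fun (measurableSet_shift2 hΩ'.measurableSet h) fun x hx => ?_
        obtain ⟨hx0, hx1, hx2⟩ := hx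
        have e : x + 2 • h = x + h + h := by rw [two_nsmul, add_assoc]
        rw [e] at hx2
        simp only [diff2, e, hηE _ hx0, hηE _ hx1, hvu _ (hsub hx0), hvu _ (hsub hx1),
          hvu _ (hsub hx2)]
        ring
    _ ≤ ∫ x, (η (x + h) * (v (x + h + h) - v (x + h)) - η x * (v (x + h) - v x)) ^ 2 :=
        setIntegral_le_integral hi (ae_of_all _ fun _ => sq_nonneg _)
    _ ≤ _ := hle
    _ = _ := by ring

lemma L2norm_diff2_sq_le {U Ω : Set (V n)} (hU : MeasurableSet U) (hΩ : MeasurableSet Ω)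
    (hUΩ : U ⊆ Ω) {u : V n → ℝ} (hu : IntegrableOn (fun x => u x ^ 2) Ω) (z : V n) :
    L2norm (shift2 U z) (diff2 z u) ^ 2 ≤ 16 * L2norm Ω u ^ 2 := by
  obtain ⟨hi, he⟩ := integrable_sq_indicator hΩ hu
  set w := Ω.indicator u with hw
  have h1 := hi.comp_add_right z
  have h2 := hi.comp_add_right (2 • z)
  have e1 := integral_add_right_eq_self (μ := volume) (fun x => w x ^ 2) z
  have e2 := integral_add_right_eq_self (μ := volume) (fun x => w x ^ 2) (2 • z)
  rw [L2norm_eq_sqrt, L2norm_eq_sqrt, Real.sq_sqrt (integral_nonneg fun _ => sq_nonneg _),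
    Real.sq_sqrt (integral_nonneg fun _ => sq_nonneg _), ← he]
  have h3 : Integrable (fun x => 4 * w (x + 2 • z) ^ 2 + 8 * w (x + z) ^ 2) :=
    (h2.const_mul 4).add (h1.const_mul 8)
  have hg : Integrable (fun x => 4 * w (x + 2 • z) ^ 2 + 8 * w (x + z) ^ 2 + 4 * w x ^ 2) :=
    h3.add (hi.const_mul 4)
  calc ∫ x in shift2 U z, diff2 z u x ^ 2
      ≤ ∫ x in shift2 U z, (4 * w (x + 2 • z) ^ 2 + 8 * w (x + z) ^ 2 + 4 * w x ^ 2) := by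
        refine integral_mono_of_nonneg (ae_of_all _ fun _ => sq_nonneg _) hg.integrableOn ?_
        refine (ae_restrict_iff' (measurableSet_shift2 hU z)).2 (ae_of_all _ fun x hx => ?_)
        obtain ⟨hx0, hx1, hx2⟩ := hx
        simp only [diff2, hw, indicator_of_mem (hUΩ hx0), indicator_of_mem (hUΩ hx1),
          indicator_of_mem (hUΩ hx2)]
        nlinarith [sq_nonneg (u (x + 2 • z) - u x), sq_nonneg (u (x + 2 • z) + u x),
          sq_nonneg (u (x + 2 • z) + 2 * u (x + z) + u x), sq_nonneg (u (x + 2 • z) + u (x + z)),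
          sq_nonneg (u x + u (x + z))]
    _ ≤ ∫ x, (4 * w (x + 2 • z) ^ 2 + 8 * w (x + z) ^ 2 + 4 * w x ^ 2) :=
        setIntegral_le_integral hg (ae_of_all _ fun _ => by positivity)
    _ = 16 * ∫ x, w x ^ 2 := by
        rw [integral_add h3 (hi.const_mul 4),
          integral_add (h2.const_mul 4) (h1.const_mul 8), integral_const_mul, integral_const_mul,
          integral_const_mul, e1, e2]
        ring

lemma integrable_norm_rpow_inside (hn : 1 ≤ n) {a : ℝ} (ha : 0 < a) (δ : ℝ) :
    Integrable ((closedBall (0 : V n) δ).indicator fun z => ‖z‖ ^ (a - n)) := by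
  rw [integrable_indicator_iff measurableSet_closedBall]
  have h : IntegrableOn (fun z : V n => ‖z‖ ^ (a - n)) (ball 0 (δ + 1)) := by
    refine integrableOn_ball_of_norm_le_rpow (C := 1) (α := n - a) (by simpa using hn)
      (by simp; linarith) (ae_of_all _ fun x => ?_)
      (measurable_norm.pow_const _).aestronglyMeasurable
    rw [Real.norm_of_nonneg (by positivity), one_mul, neg_sub]
  exact h.mono_set (closedBall_subset_ball (by linarith))

lemma integrable_norm_rpow_outside {a δ : ℝ} (ha : 0 < a) (hδ : 0 < δ) :
    Integrable ((closedBall (0 : V n) δ)ᶜ.indicator fun z => ‖z‖ ^ (-((n : ℝ) + a))) := by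
  have h := (integrable_one_add_norm (E := V n) (μ := volume) (r := n + a)
    (by rw [finrank_V]; linarith)).const_mul ((1 / δ + 1) ^ ((n : ℝ) + a))
  refine h.mono' (Measurable.aestronglyMeasurable (Measurable.indicator (by fun_prop)
    measurableSet_closedBall.compl)) (ae_of_all _ fun z => ?_)
  by_cases hz : z ∈ (closedBall (0 : V n) δ)ᶜ
  · have hz' : δ < ‖z‖ := by simpa using hz
    have hz0 : 0 < ‖z‖ := hδ.trans hz'
    rw [indicator_of_mem hz, Real.norm_of_nonneg (by positivity), Real.rpow_neg (by positivity),
      Real.rpow_neg (by positivity), ← div_eq_mul_inv, inv_eq_one_div,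
      div_le_div_iff₀ (by positivity) (by positivity), one_mul,
      ← Real.mul_rpow (by positivity) (by positivity)]
    refine Real.rpow_le_rpow (by positivity) ?_ (by positivity)
    have : 1 ≤ 1 / δ * ‖z‖ := by
      rw [one_div_mul_eq_div, le_div_iff₀ hδ]; linarith
    linarith
  · rw [indicator_of_notMem hz, norm_zero]
    positivity

/-- **Theorem (interior `H^{2s-ε}` regularity).** A weak solution of `E_K(u,·)=f` in `Ω`
satisfies the Besov/Sobolev estimate of order `2s-ε` on every `Ω' ⊂⊂ Ω`. -/
theorem sobolev_interior_regularity {n : ℕ} (hn : 1 ≤ n)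
    (s β lam Lam M Gam : ℝ) (hs : s ∈ Ioo (0 : ℝ) 1) (hβ : 0 < β)
    (hlam : 0 < lam) (hlL : lam ≤ Lam) (hM : 0 < M) (hGam : 0 < Gam)
    (Ω : Set (V n)) (hΩ : IsOpen Ω)
    (ε : ℝ) (hε : ε ∈ Ioo (0 : ℝ) (2 * s))
    (Ω' : Set (V n)) (hΩ' : IsOpen Ω') (hΩ'c : IsCompact (closure Ω'))
    (hΩ'Ω : closure Ω' ⊆ Ω) :
    ∃ C > 0, ∀ (K : V n → V n → ℝ) (u f : V n → ℝ),
      Measurable (Function.uncurry K) → (∀ x y, 0 ≤ K x y) →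
      KSym K → KBounds s β lam Lam M K → KHolder s Gam K →
      MemX Ω K u → HasFiniteWnorm β 0 u →
      Measurable f → IntegrableOn (fun x => f x ^ 2) Ω →
      IsSolution Ω K u f →
      ENNReal.ofReal (L2norm Ω' u) +
          (∫⁻ z : V n, ENNReal.ofReal
              ((‖z‖ ^ (-(2 * s - ε)) * L2norm (shift2 Ω' z) (diff2 z u)) ^ 2
                * ‖z‖ ^ (-(n : ℝ)))) ^ ((1 : ℝ) / 2) ≤
        ENNReal.ofReal (C * (L2norm Ω u + wnorm β 0 u + L2norm Ω f)) := by
  have hε0 := hε.1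
  have hα : 0 < 2 * s - ε := sub_pos.2 hε.2
  have hsub : Ω' ⊆ Ω := subset_closure.trans hΩ'Ω
  obtain ⟨δ, hδ0, C, hC, hsmall⟩ := exists_L2norm_diff2_le_of_small hn hs.1 hs.2 hβ hlam hlL hM
    hGam hΩ hΩ' hΩ'c hΩ'Ω
  have hG₁ := integrable_norm_rpow_inside hn (mul_pos two_pos hε0) δ
  have hG₂ := integrable_norm_rpow_outside (n := n) (mul_pos two_pos hα) hδ0
  set G₁ := (closedBall (0 : V n) δ).indicator fun z => ‖z‖ ^ (2 * ε - n)
  set G₂ := (closedBall (0 : V n) δ)ᶜ.indicator fun z => ‖z‖ ^ (-((n : ℝ) + 2 * (2 * s - ε)))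
  have hG : Integrable (fun z => C * G₁ z + 16 * G₂ z) :=
    (hG₁.const_mul C).add (hG₂.const_mul 16)
  have hG₁0 : ∀ z, 0 ≤ G₁ z := indicator_nonneg fun z _ => by positivity
  have hG₂0 : ∀ z, 0 ≤ G₂ z := indicator_nonneg fun z _ => by positivity
  set J := ∫ z, (C * G₁ z + 16 * G₂ z)
  have hJ : 0 ≤ J := integral_nonneg fun z =>
    add_nonneg (mul_nonneg hC (hG₁0 z)) (mul_nonneg (by norm_num) (hG₂0 z))
  refine ⟨1 + √J, by positivity, ?_⟩
  intro K u f hKm hK0 _ hK hKH hu huw hf hf2 hsol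
  have hsm := hsmall K u f hKm hK0 hK hKH hu huw hf hf2 hsol
  set N := L2norm Ω u + wnorm β 0 u + L2norm Ω f with hN
  have hnu : 0 ≤ L2norm Ω u := by rw [L2norm_eq_sqrt]; positivity
  have hnf : 0 ≤ L2norm Ω f := by rw [L2norm_eq_sqrt]; positivity
  have hnw : 0 ≤ wnorm β 0 u := integral_nonneg fun x => by positivity
  have hN0 : 0 ≤ N := by positivity
  have huN : L2norm Ω u ≤ N := by linarith
  have : NeZero n := ⟨by omega⟩
  have hne : ∀ᵐ z : V n, z ≠ 0 := by
    have : Nontrivial (V n) := by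
      unfold V; infer_instance
    exact Measure.ae_ne volume 0
  have hpt : ∀ᵐ z : V n, (‖z‖ ^ (-(2 * s - ε)) * L2norm (shift2 Ω' z) (diff2 z u)) ^ 2
      * ‖z‖ ^ (-(n : ℝ)) ≤ (C * G₁ z + 16 * G₂ z) * N ^ 2 := by
    filter_upwards [hsm, hne] with z hz h0
    have hz0 : 0 < ‖z‖ := norm_pos_iff.2 h0
    have hA : 0 ≤ (‖z‖ ^ (-(2 * s - ε))) ^ 2 * ‖z‖ ^ (-(n : ℝ)) := by positivity
    have e : ∀ L : ℝ, (‖z‖ ^ (-(2 * s - ε)) * L) ^ 2 * ‖z‖ ^ (-(n : ℝ)) =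
        (‖z‖ ^ (-(2 * s - ε))) ^ 2 * ‖z‖ ^ (-(n : ℝ)) * L ^ 2 := fun L => by ring
    rw [e]
    by_cases hzδ : ‖z‖ ≤ δ
    · have hm : z ∈ closedBall (0 : V n) δ := by simpa using hzδ
      have e1 : G₁ z = (‖z‖ ^ (-(2 * s - ε))) ^ 2 * ‖z‖ ^ (-(n : ℝ)) * (‖z‖ ^ (2 * s)) ^ 2 := by
        simp only [G₁, indicator_of_mem hm, ← Real.rpow_mul_natCast hz0.le, ← Real.rpow_add hz0]
        congr 1
        push_cast
        ring
      have := mul_le_mul_of_nonneg_left (hz h0 hzδ) hA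
      have h2 := mul_nonneg (hG₂0 z) (sq_nonneg N)
      refine this.trans ?_
      rw [e1]
      nlinarith
    · have hm : z ∈ (closedBall (0 : V n) δ)ᶜ := by simpa using hzδ
      have e2 : G₂ z = (‖z‖ ^ (-(2 * s - ε))) ^ 2 * ‖z‖ ^ (-(n : ℝ)) := by
        simp only [G₂, indicator_of_mem hm, ← Real.rpow_mul_natCast hz0.le, ← Real.rpow_add hz0]
        congr 1
        push_cast
        ring
      have h1 := L2norm_diff2_sq_le hΩ'.measurableSet hΩ.measurableSet hsub hu.2.1 z
      have h3 : L2norm Ω u ^ 2 ≤ N ^ 2 := pow_le_pow_left₀ hnu huN 2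
      have := mul_le_mul_of_nonneg_left (h1.trans (mul_le_mul_of_nonneg_left h3 (by norm_num))) hA
      have h2 := mul_nonneg (mul_nonneg hC (hG₁0 z)) (sq_nonneg N)
      refine this.trans ?_
      rw [e2]
      nlinarith
  have hint : ∫⁻ z : V n, ENNReal.ofReal
      ((‖z‖ ^ (-(2 * s - ε)) * L2norm (shift2 Ω' z) (diff2 z u)) ^ 2 * ‖z‖ ^ (-(n : ℝ))) ≤
      ENNReal.ofReal (J * N ^ 2) := by
    rw [← integral_mul_const, ofReal_integral_eq_lintegral_ofReal (hG.mul_const _)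
      (ae_of_all _ fun z => mul_nonneg (add_nonneg (mul_nonneg hC (hG₁0 z))
        (mul_nonneg (by norm_num) (hG₂0 z))) (sq_nonneg N))]
    exact lintegral_mono_ae (hpt.mono fun z hz => ENNReal.ofReal_le_ofReal hz)
  have hroot : (J * N ^ 2) ^ ((1 : ℝ) / 2) = √J * N := by
    rw [← Real.sqrt_eq_rpow, Real.sqrt_mul hJ, Real.sqrt_sq hN0]
  have hle : L2norm Ω' u ≤ N := by
    refine le_trans ?_ huN
    rw [L2norm_eq_sqrt, L2norm_eq_sqrt]
    exact Real.sqrt_le_sqrt (setIntegral_mono_set hu.2.1 (ae_of_all _ fun _ => sq_nonneg _)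
      hsub.eventuallyLE)
  rw [add_mul, one_mul, ENNReal.ofReal_add hN0 (by positivity), ← hroot,
    ← ENNReal.ofReal_rpow_of_nonneg (by positivity) (by norm_num)]
  exact add_le_add (ENNReal.ofReal_le_ofReal hle) (ENNReal.rpow_le_rpow hint (by norm_num))
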